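/- arXiv:2307.07804 — 2 statements merged into one kernel-verified Lean document; each statement's English description precedes it below -/
import Mathlib

section
/- There exist ℂ-subspaces T₁, …, T_{n+1−r} of I(n), each invariant under the right-translation action of G, such that I(n) is their internal direct sum, each T_i has no G-invariant subspace other than 0 and itself, and for i ≠ j the representations of G on T_i and T_j are not isomorphic. In particular the representation I(n) of G is multiplicity free with exactly n + 1 − r irreducible constituents. -/
noncomputable section

/-- `y(t) = (1,0;t,1)` as an element of `GL₂(R)`. -/
def yG {R : Type*} [CommRing R] (t : R) : GL (Fin 2) R :=
  ⟨!![1, 0; t, 1], !![1, 0; -t, 1],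
   by ext i j; fin_cases i <;> fin_cases j <;> simp [Matrix.mul_apply, Fin.sum_univ_two],
   by ext i j; fin_cases i <;> fin_cases j <;> simp [Matrix.mul_apply, Fin.sum_univ_two]⟩

/-- Membership in the subgroup `B` of invertible upper triangular matrices. -/
def inB {R : Type*} [CommRing R] (g : GL (Fin 2) R) : Prop :=
  (g : Matrix (Fin 2) (Fin 2) R) 1 0 = 0

/-- `χ_B(b) = χ(d_b)`, where `d_b` is the `(2,2)`-entry of `b` (for `b ∈ B` this entry is a
unit; the function is extended by `0` elsewhere). -/
def chiB {R : Type*} [CommRing R] (χ : Rˣ →* ℂˣ) (g : GL (Fin 2) R) : ℂ :=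
  letI := Classical.dec (IsUnit ((g : Matrix (Fin 2) (Fin 2) R) 1 1))
  if h : IsUnit ((g : Matrix (Fin 2) (Fin 2) R) 1 1) then (χ h.unit : ℂ) else 0

/-- `|B|`. -/
def cardB (R : Type*) [CommRing R] : ℕ := Nat.card {g : GL (Fin 2) R // inB g}

/-- Convolution `(f*g)(x) = |B|⁻¹ Σ_{y∈G} f(y) g(y⁻¹x)`. -/
def conv {R : Type*} [CommRing R] [Fintype R] [DecidableEq R]
    (f g : GL (Fin 2) R → ℂ) : GL (Fin 2) R → ℂ :=
  fun x => (cardB R : ℂ)⁻¹ * ∑ y : GL (Fin 2) R, f y * g (y⁻¹ * x)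

/-- Membership in the Hecke algebra `H(χ)` of `χ_B`-bi-equivariant functions on `G`. -/
def memH {R : Type*} [CommRing R] (χ : Rˣ →* ℂˣ) (f : GL (Fin 2) R → ℂ) : Prop :=
  ∀ b x b' : GL (Fin 2) R, inB b → inB b' →
    f (b * x * b') = chiB χ b * chiB χ b' * f x

/-- `V_j`: the unique element of `H(χ)` vanishing off the double coset `B y_j B` with
`V_j(y_j) = 1`, where `y_j = (1,0;p^j,1)`. -/
def isV (p n : ℕ) (χ : (ZMod (p ^ n))ˣ →* ℂˣ) (j : ℕ)
    (V : GL (Fin 2) (ZMod (p ^ n)) → ℂ) : Prop :=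
  memH χ V ∧
  (∀ x : GL (Fin 2) (ZMod (p ^ n)),
      (¬ ∃ b b' : GL (Fin 2) (ZMod (p ^ n)), inB b ∧ inB b' ∧
          x = b * yG ((p : ZMod (p ^ n)) ^ j) * b') → V x = 0) ∧
  V (yG ((p : ZMod (p ^ n)) ^ j)) = 1

/-- `χ` has conductor `p^r`: trivial on units `≡ 1 (mod p^r)`, nontrivial on units
`≡ 1 (mod p^{r−1})`. -/
def hasConductor (p n r : ℕ) (χ : (ZMod (p ^ n))ˣ →* ℂˣ) : Prop :=
  (∀ u : (ZMod (p ^ n))ˣ, (p : ZMod (p ^ n)) ^ r ∣ ((u : ZMod (p ^ n)) - 1) → χ u = 1) ∧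
  ∃ u : (ZMod (p ^ n))ˣ, (p : ZMod (p ^ n)) ^ (r - 1) ∣ ((u : ZMod (p ^ n)) - 1) ∧ χ u ≠ 1

/-- `I(n) = {φ : G → ℂ : φ(bx) = χ_B(b)φ(x) for all b ∈ B, x ∈ G}` as a `ℂ`-subspace of
the functions `G → ℂ`. -/
def Isub (p n : ℕ) (χ : (ZMod (p ^ n))ˣ →* ℂˣ) :
    Submodule ℂ (GL (Fin 2) (ZMod (p ^ n)) → ℂ) where
  carrier := {φ | ∀ b x : GL (Fin 2) (ZMod (p ^ n)), inB b → φ (b * x) = chiB χ b * φ x}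
  add_mem' := by
    intro f g hf hg b x hb
    simp only [Pi.add_apply, hf b x hb, hg b x hb]; ring
  zero_mem' := by intro b x hb; simp
  smul_mem' := by
    intro c f hf b x hb
    simp only [Pi.smul_apply, hf b x hb, smul_eq_mul]; ring

/-- A subspace of functions on `G` is invariant under the right-translation action
`(π_R(g)φ)(x) = φ(xg)`. -/
def invariant (p n : ℕ) (S : Submodule ℂ (GL (Fin 2) (ZMod (p ^ n)) → ℂ)) : Prop :=
  ∀ (g : GL (Fin 2) (ZMod (p ^ n))) (φ : GL (Fin 2) (ZMod (p ^ n)) → ℂ),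
    φ ∈ S → (fun x => φ (x * g)) ∈ S

namespace HeckeChain

/-- A linearly independent family in a subspace on which as many linear functionals separate
points spans that subspace. -/
lemma exists_eq_sum_of_linearIndependent {V ι : Type*} [Fintype ι] [AddCommGroup V]
    [Module ℂ V] (W : Submodule ℂ V) (Φ : V →ₗ[ℂ] (ι → ℂ))
    (hΦ : ∀ v ∈ W, Φ v = 0 → v = 0) (E : ι → V) (hEW : ∀ i, E i ∈ W)
    (hE : LinearIndependent ℂ E) {v : V} (hv : v ∈ W) : ∃ a : ι → ℂ, v = ∑ i, a i • E i := by
  have hinj : Function.Injective (Φ ∘ₗ W.subtype) :=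
    (injective_iff_map_eq_zero _).2 fun w hw => Subtype.ext (hΦ w w.2 hw)
  have : FiniteDimensional ℂ W := FiniteDimensional.of_injective _ hinj
  have hle : Submodule.span ℂ (Set.range E) ≤ W :=
    Submodule.span_le.2 (Set.range_subset_iff.2 hEW)
  have heq : Submodule.span ℂ (Set.range E) = W := by
    refine Submodule.eq_of_le_of_finrank_le hle ?_
    rw [finrank_span_eq_card hE]
    simpa using LinearMap.finrank_le_finrank_of_injective hinj
  rw [← heq] at hv
  obtain ⟨a, ha⟩ := (Submodule.mem_span_range_iff_exists_fun ℂ).1 hv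
  exact ⟨a, ha.symm⟩

section Abstract

variable {G : Type*} [Group G]

/-- Right translation `(R(g)φ)(x) = φ(xg)` as a linear endomorphism of the functions on `G`. -/
def rightTranslation (g : G) : Module.End ℂ (G → ℂ) :=
  LinearMap.funLeft ℂ ℂ (· * g)

@[simp] lemma rightTranslation_apply (g : G) (φ : G → ℂ) :
    rightTranslation g φ = fun x => φ (x * g) := rfl

lemma rightTranslation_mul (g h : G) :
    rightTranslation (g * h) = rightTranslation g * rightTranslation h := by
  ext φ x
  simp [mul_assoc]

lemma rightTranslation_one : rightTranslation (1 : G) = 1 := by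
  ext φ x
  simp

/-- Maschke's theorem for function spaces: an invariant subspace is the image of an equivariant
projection. -/
lemma exists_equivariant_projection [Fintype G] (S : Submodule ℂ (G → ℂ))
    (hS : ∀ g, ∀ φ ∈ S, rightTranslation g φ ∈ S) :
    ∃ Q : Module.End ℂ (G → ℂ), (∀ g, Commute Q (rightTranslation g)) ∧
      (∀ φ, Q φ ∈ S) ∧ ∀ φ ∈ S, Q φ = φ := by
  obtain ⟨π, hπ⟩ := S.subtype.exists_leftInverse_of_injective S.ker_subtype
  have hπ' : ∀ φ (h : φ ∈ S), π φ = ⟨φ, h⟩ := fun φ h => LinearMap.congr_fun hπ ⟨φ, h⟩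
  let π₀ : Module.End ℂ (G → ℂ) := S.subtype ∘ₗ π
  have hcard : (Fintype.card G : ℂ) ≠ 0 := Nat.cast_ne_zero.2 Fintype.card_ne_zero
  refine ⟨(Fintype.card G : ℂ)⁻¹ • ∑ g : G, rightTranslation g⁻¹ * π₀ * rightTranslation g,
    fun g => ?_, fun φ => ?_, fun φ hφ => ?_⟩
  · refine Commute.smul_left ?_ _
    change _ * _ = _ * _
    rw [Finset.sum_mul, Finset.mul_sum]
    refine Fintype.sum_equiv (Equiv.mulRight g) _ _ fun h => ?_
    simp only [Equiv.coe_mulRight, mul_inv_rev]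
    rw [mul_assoc, ← rightTranslation_mul, rightTranslation_mul g⁻¹ h⁻¹]
    simp only [← mul_assoc]
    rw [← rightTranslation_mul, mul_inv_cancel, rightTranslation_one, one_mul]
  · rw [LinearMap.smul_apply, LinearMap.sum_apply]
    exact S.smul_mem _ (S.sum_mem fun g _ => hS _ _ (π (rightTranslation g φ)).2)
  · rw [LinearMap.smul_apply, LinearMap.sum_apply]
    have : ∀ g : G, (rightTranslation g⁻¹ * π₀ * rightTranslation g) φ = φ := by
      intro g
      change rightTranslation g⁻¹ (π (rightTranslation g φ) : G → ℂ) = φ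
      rw [hπ' _ (hS g φ hφ)]
      ext x
      simp
    simp only [this, Finset.sum_const, Finset.card_univ, ← Nat.cast_smul_eq_nsmul ℂ, smul_smul,
      inv_mul_cancel₀ hcard, one_smul]

open Classical in
/-- The function equal to `c` on `K` and to `0` elsewhere. -/
noncomputable def charFun (K : Subgroup G) (c : G → ℂ) : G → ℂ :=
  fun h => if h ∈ K then c h else 0

/-- `c` restricts to a linear character of `K`. -/
structure IsCharOn (K : Subgroup G) (c : G → ℂ) : Prop where
  one : c 1 = 1
  mul : ∀ h ∈ K, ∀ k ∈ K, c (h * k) = c h * c k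

/-- `φ(kx) = c(k)φ(x)` for `k ∈ K`. -/
def LeftEquivariant (K : Subgroup G) (c : G → ℂ) (φ : G → ℂ) : Prop :=
  ∀ k ∈ K, ∀ x, φ (k * x) = c k * φ x

variable {K L : Subgroup G} {c : G → ℂ}

lemma IsCharOn.mono (hc : IsCharOn L c) (h : K ≤ L) : IsCharOn K c :=
  ⟨hc.one, fun a ha b hb => hc.mul a (h ha) b (h hb)⟩

lemma IsCharOn.mul_inv_eq_one (hc : IsCharOn K c) {k : G} (hk : k ∈ K) : c k * c k⁻¹ = 1 := by
  rw [← hc.mul _ hk _ (inv_mem hk), mul_inv_cancel, hc.one]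

lemma IsCharOn.charFun_left (hc : IsCharOn K c) {k : G} (hk : k ∈ K) (x : G) :
    charFun K c (k * x) = c k * charFun K c x := by
  by_cases hx : x ∈ K
  · simp [charFun, hx, mul_mem hk hx, hc.mul k hk x hx]
  · simp [charFun, hx, K.mul_mem_cancel_left hk]

lemma IsCharOn.charFun_right (hc : IsCharOn K c) {k : G} (hk : k ∈ K) (x : G) :
    charFun K c (x * k) = charFun K c x * c k := by
  by_cases hx : x ∈ K
  · simp [charFun, hx, mul_mem hx hk, hc.mul x hx k hk]
  · simp [charFun, hx, K.mul_mem_cancel_right hk]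

/-- A descending chain of subgroups with a common character, whose smallest member has a Hecke
algebra of dimension at most the length of the chain. -/
structure IsHeckeChain (K : ℕ → Subgroup G) (c : G → ℂ) (N : ℕ) (y : Fin (N + 1) → G) :
    Prop where
  antitone : Antitone K
  isCharOn : IsCharOn (K 0) c
  strict : ∀ j < N, ∃ k ∈ K j, k ∉ K (j + 1)
  eq_zero : ∀ f : G → ℂ, LeftEquivariant (K N) c f →
    (∀ b ∈ K N, ∀ x, f (x * b) = c b * f x) → (∀ i, f (y i) = 0) → f = 0

namespace IsHeckeChain

variable {K : ℕ → Subgroup G} {N : ℕ} {y : Fin (N + 1) → G}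

lemma isCharOn_apply (H : IsHeckeChain K c N y) (j : ℕ) : IsCharOn (K j) c :=
  H.isCharOn.mono (H.antitone (Nat.zero_le j))

lemma leftEquivariant_charFun (H : IsHeckeChain K c N y) (j : ℕ) :
    LeftEquivariant (K j) c (charFun (K j) c) :=
  fun _ hk x => (H.isCharOn_apply j).charFun_left hk x

lemma charFun_one (H : IsHeckeChain K c N y) (j : ℕ) : charFun (K j) c 1 = 1 := by
  simp [charFun, H.isCharOn.one]

end IsHeckeChain

variable [Fintype G]

/-- The projection of `G → ℂ` onto the left `(K, c)`-equivariant functions. -/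
noncomputable def proj (K : Subgroup G) (c : G → ℂ) : Module.End ℂ (G → ℂ) where
  toFun φ := fun x => (Nat.card K : ℂ)⁻¹ * ∑ h : G, charFun K c h * φ (h⁻¹ * x)
  map_add' φ ψ := by
    ext x
    simp [mul_add, Finset.sum_add_distrib]
  map_smul' a φ := by
    ext x
    simp only [Pi.smul_apply, smul_eq_mul, RingHom.id_apply, Finset.mul_sum]
    exact Finset.sum_congr rfl fun _ _ => by ring

lemma proj_apply (φ : G → ℂ) (x : G) :
    proj K c φ x = (Nat.card K : ℂ)⁻¹ * ∑ h : G, charFun K c h * φ (h⁻¹ * x) := rfl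

lemma card_subgroup_ne_zero : (Nat.card K : ℂ) ≠ 0 :=
  Nat.cast_ne_zero.2 Nat.card_pos.ne'

open Classical in
lemma sum_indicator_subgroup (a : ℂ) :
    ∑ h : G, (if h ∈ K then a else 0) = Nat.card K * a := by
  rw [Finset.sum_ite, Finset.sum_const_zero, add_zero, Finset.sum_const, nsmul_eq_mul]
  congr 2
  rw [Nat.card_eq_fintype_card, Fintype.card_subtype]

lemma commute_proj_rightTranslation (g : G) :
    Commute (proj K c) (rightTranslation g) := by
  change _ * _ = _ * _
  ext φ x
  simp [proj_apply, mul_assoc]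

lemma leftEquivariant_proj (hc : IsCharOn K c) (φ : G → ℂ) :
    LeftEquivariant K c (proj K c φ) := by
  intro k hk x
  rw [proj_apply, proj_apply, mul_left_comm]
  refine congrArg _ ?_
  rw [Finset.mul_sum]
  rw [← Equiv.sum_comp (Equiv.mulLeft k)]
  refine Finset.sum_congr rfl fun h _ => ?_
  simp only [Equiv.coe_mulLeft, hc.charFun_left hk, mul_inv_rev, mul_assoc, inv_mul_cancel_left]

lemma proj_eq_self (hc : IsCharOn K c) {φ : G → ℂ} (hφ : LeftEquivariant K c φ) :
    proj K c φ = φ := by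
  classical
  ext x
  have : ∀ h : G, charFun K c h * φ (h⁻¹ * x) = if h ∈ K then φ x else 0 := by
    intro h
    by_cases hh : h ∈ K
    · simp only [charFun, if_pos hh]
      rw [hφ _ (inv_mem hh), ← mul_assoc, hc.mul_inv_eq_one hh, one_mul]
    · simp [charFun, hh]
  rw [proj_apply, Finset.sum_congr rfl fun h _ => this h, sum_indicator_subgroup,
    inv_mul_cancel_left₀ card_subgroup_ne_zero]

lemma proj_mul_proj_of_le (hc : IsCharOn L c) (h : K ≤ L) : proj K c * proj L c = proj L c := by
  exact LinearMap.ext fun φ => proj_eq_self (hc.mono h)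
    fun k hk x => leftEquivariant_proj hc φ k (h hk) x

lemma proj_mul_proj_of_ge (hc : IsCharOn L c) (hKL : K ≤ L) :
    proj L c * proj K c = proj L c := by
  classical
  refine LinearMap.ext fun φ => funext fun x => ?_
  change proj L c (proj K c φ) x = proj L c φ x
  simp only [proj_apply, Finset.mul_sum]
  rw [Finset.sum_comm]
  have key : ∀ k : G, ∑ h : G, (Nat.card L : ℂ)⁻¹ * (charFun L c h *
      ((Nat.card K : ℂ)⁻¹ * (charFun K c k * φ (k⁻¹ * (h⁻¹ * x))))) =
      if k ∈ K then (Nat.card K : ℂ)⁻¹ *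
        ∑ h : G, (Nat.card L : ℂ)⁻¹ * (charFun L c h * φ (h⁻¹ * x)) else 0 := by
    intro k
    by_cases hk : k ∈ K
    · rw [if_pos hk, ← Equiv.sum_comp (Equiv.mulRight k⁻¹), Finset.mul_sum]
      refine Finset.sum_congr rfl fun h _ => ?_
      have h1 : charFun K c k = c k := if_pos hk
      simp only [Equiv.coe_mulRight, hc.charFun_right (inv_mem (hKL hk)), h1, mul_inv_rev,
        inv_inv, mul_assoc, inv_mul_cancel_left]
      linear_combination (Nat.card L : ℂ)⁻¹ * (Nat.card K : ℂ)⁻¹ * charFun L c h *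
        φ (h⁻¹ * x) * hc.mul_inv_eq_one (hKL hk)
    · simp [charFun, hk]
  rw [Finset.sum_congr rfl fun k _ => key k, sum_indicator_subgroup,
    mul_inv_cancel_left₀ card_subgroup_ne_zero]

/-- The image of `proj K c` is spanned by the right translates of `charFun K c`. -/
lemma proj_eq_sum_rightTranslation (φ : G → ℂ) :
    proj K c φ = ∑ g : G, ((Nat.card K : ℂ)⁻¹ * φ g) • rightTranslation g⁻¹ (charFun K c) := by
  ext x
  rw [proj_apply, Finset.mul_sum, Finset.sum_apply,
    ← Equiv.sum_comp ((Equiv.inv G).trans (Equiv.mulLeft x))]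
  refine Finset.sum_congr rfl fun g _ => ?_
  simp
  ring

/-- The projections attached to a chain of subgroups, preceded by `0`. -/
noncomputable def chainProj (K : ℕ → Subgroup G) (c : G → ℂ) : ℕ → Module.End ℂ (G → ℂ)
  | 0 => 0
  | j + 1 => proj (K j) c

/-- The successive differences of the projections of a chain. -/
noncomputable def component (K : ℕ → Subgroup G) (c : G → ℂ) (i : ℕ) : Module.End ℂ (G → ℂ) :=
  chainProj K c (i + 1) - chainProj K c i

lemma commute_component_rightTranslation (K : ℕ → Subgroup G) (i : ℕ) (g : G) :
    Commute (component K c i) (rightTranslation g) := by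
  have h : ∀ j, Commute (chainProj K c j) (rightTranslation g) := by
    rintro (_ | j)
    · exact Commute.zero_left _
    · exact commute_proj_rightTranslation g
  exact (h _).sub_left (h _)

lemma component_rightTranslation (K : ℕ → Subgroup G) (i : ℕ) (g : G) (φ : G → ℂ) :
    component K c i (rightTranslation g φ) = rightTranslation g (component K c i φ) := by
  rw [← Module.End.mul_apply, (commute_component_rightTranslation K i g).eq,
    Module.End.mul_apply]

lemma sum_component (K : ℕ → Subgroup G) (N : ℕ) :
    ∑ i : Fin (N + 1), component K c i = proj (K N) c := by
  rw [Fin.sum_univ_eq_sum_range (fun i => component K c i)]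
  simp only [component, Finset.sum_range_sub]
  simp [chainProj]

namespace IsHeckeChain

variable {K : ℕ → Subgroup G} {N : ℕ} {y : Fin (N + 1) → G}

lemma chainProj_mul (H : IsHeckeChain K c N y) (a b : ℕ) :
    chainProj K c a * chainProj K c b = chainProj K c (min a b) := by
  rcases a with _ | a
  · simp [chainProj]
  rcases b with _ | b
  · simp [chainProj]
  rcases le_total a b with h | h
  · rw [min_eq_left (by lia)]
    exact proj_mul_proj_of_ge (H.isCharOn_apply a) (H.antitone h)
  · rw [min_eq_right (by lia)]
    exact proj_mul_proj_of_le (H.isCharOn_apply b) (H.antitone h)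

lemma component_mul_self (H : IsHeckeChain K c N y) (i : ℕ) :
    component K c i * component K c i = component K c i := by
  simp [component, mul_sub, sub_mul, H.chainProj_mul]

lemma component_mul_of_ne (H : IsHeckeChain K c N y) {i j : ℕ} (hij : i ≠ j) :
    component K c i * component K c j = 0 := by
  simp only [component, mul_sub, sub_mul, H.chainProj_mul]
  rcases lt_or_gt_of_ne hij with h | h
  · rw [min_eq_left (by lia : i + 1 ≤ j + 1), min_eq_left (by lia : i ≤ j + 1),
      min_eq_left (by lia : i + 1 ≤ j), min_eq_left h.le]
    abel
  · rw [min_eq_right (by lia : j + 1 ≤ i + 1), min_eq_right (by lia : j + 1 ≤ i),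
      min_eq_right (by lia : j ≤ i + 1), min_eq_right h.le]
    abel

lemma proj_mul_component (H : IsHeckeChain K c N y) {i : ℕ} (hi : i ≤ N) :
    proj (K N) c * component K c i = component K c i := by
  change chainProj K c (N + 1) * _ = _
  rw [component, mul_sub, H.chainProj_mul, H.chainProj_mul, min_eq_right (by lia),
    min_eq_right (by lia)]

lemma component_mul_proj (H : IsHeckeChain K c N y) {i : ℕ} (hi : i ≤ N) :
    component K c i * proj (K N) c = component K c i := by
  change _ * chainProj K c (N + 1) = _
  rw [component, sub_mul, H.chainProj_mul, H.chainProj_mul, min_eq_left (by lia),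
    min_eq_left (by lia)]

lemma component_ne_zero (H : IsHeckeChain K c N y) {i : ℕ} (hi : i ≤ N) :
    component K c i ≠ 0 := by
  intro h0
  have hself := proj_eq_self (H.isCharOn_apply i) (H.leftEquivariant_charFun i)
  have h1 := H.charFun_one i
  rcases i with _ | j
  · have h2 : proj (K 0) c = 0 := by simpa [component, chainProj] using h0
    rw [← hself, h2] at h1
    simp at h1
  · have h2 : proj (K (j + 1)) c = proj (K j) c := sub_eq_zero.1 h0
    obtain ⟨k, hk, hk'⟩ := H.strict j hi
    have h3 := leftEquivariant_proj (H.isCharOn_apply j) (charFun (K (j + 1)) c) k hk 1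
    rw [← h2, hself, h1, mul_one, mul_one, charFun, if_neg hk'] at h3
    have h4 := (H.isCharOn_apply j).mul_inv_eq_one hk
    rw [← h3, zero_mul] at h4
    exact zero_ne_one h4

lemma linearIndependent_component (H : IsHeckeChain K c N y) :
    LinearIndependent ℂ fun i : Fin (N + 1) => component K c i := by
  refine Fintype.linearIndependent_iff.2 fun a ha i => ?_
  have h := congrArg (component K c i * ·) ha
  simp only [Finset.mul_sum, mul_smul_comm, mul_zero] at h
  rw [Finset.sum_eq_single i, H.component_mul_self, smul_eq_zero] at h
  · exact h.resolve_right (H.component_ne_zero (Fin.is_le i))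
  · intro j _ hj
    rw [H.component_mul_of_ne (fun h => hj (Fin.ext h.symm)), smul_zero]
  · simp

/-- The equivariant endomorphisms of the space of left equivariant functions, extended to all
functions by the projection. -/
noncomputable def equivariantEnd (K : Subgroup G) (c : G → ℂ) :
    Submodule ℂ (Module.End ℂ (G → ℂ)) where
  carrier := {A | (∀ g, Commute A (rightTranslation g)) ∧ proj K c * A = A ∧ A * proj K c = A}
  add_mem' := fun ⟨h1, h2, h3⟩ ⟨k1, k2, k3⟩ =>
    ⟨fun g => (h1 g).add_left (k1 g), by rw [mul_add, h2, k2], by rw [add_mul, h3, k3]⟩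
  zero_mem' := ⟨fun g => Commute.zero_left _, mul_zero _, zero_mul _⟩
  smul_mem' := fun a _ ⟨h1, h2, h3⟩ =>
    ⟨fun g => (h1 g).smul_left a, by rw [mul_smul_comm, h2], by rw [smul_mul_assoc, h3]⟩

lemma eq_zero_of_charFun_apply (H : IsHeckeChain K c N y) {A : Module.End ℂ (G → ℂ)}
    (hA : A ∈ equivariantEnd (K N) c) (h0 : ∀ i, A (charFun (K N) c) (y i) = 0) : A = 0 := by
  obtain ⟨h1, h2, h3⟩ := hA
  have hcomm : ∀ g φ, A (rightTranslation g φ) = rightTranslation g (A φ) := fun g φ =>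
    LinearMap.congr_fun (h1 g) φ
  have hf : A (charFun (K N) c) = 0 := by
    refine H.eq_zero _ ?_ (fun b hb x => ?_) h0
    · rw [← h2]
      exact leftEquivariant_proj (H.isCharOn_apply N) _
    · have h4 : rightTranslation b (charFun (K N) c) = c b • charFun (K N) c := by
        ext x
        simp [(H.isCharOn_apply N).charFun_right hb, mul_comm]
      have h5 := hcomm b (charFun (K N) c)
      rw [h4, map_smul] at h5
      exact (congrFun h5 x).symm
  refine LinearMap.ext fun φ => ?_
  rw [← h3, Module.End.mul_apply, proj_eq_sum_rightTranslation, map_sum]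
  refine Finset.sum_eq_zero fun g _ => ?_
  rw [map_smul, hcomm, hf, map_zero, smul_zero]

lemma component_mem_equivariantEnd (H : IsHeckeChain K c N y) {i : ℕ} (hi : i ≤ N) :
    component K c i ∈ equivariantEnd (K N) c :=
  ⟨commute_component_rightTranslation K i, H.proj_mul_component hi, H.component_mul_proj hi⟩

/-- Every equivariant endomorphism is a linear combination of the components. -/
lemma exists_eq_sum_component (H : IsHeckeChain K c N y) {A : Module.End ℂ (G → ℂ)}
    (hA : A ∈ equivariantEnd (K N) c) :
    ∃ a : Fin (N + 1) → ℂ, A = ∑ i, a i • component K c i := by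
  let Φ : Module.End ℂ (G → ℂ) →ₗ[ℂ] (Fin (N + 1) → ℂ) :=
    { toFun := fun A i => A (charFun (K N) c) (y i)
      map_add' := fun _ _ => rfl
      map_smul' := fun _ _ => rfl }
  exact exists_eq_sum_of_linearIndependent _ Φ
    (fun A hA h => H.eq_zero_of_charFun_apply hA (congrFun h)) _
    (fun i => H.component_mem_equivariantEnd (Fin.is_le i)) H.linearIndependent_component hA

lemma component_apply_of_mem_range (H : IsHeckeChain K c N y) {i : ℕ} {φ : G → ℂ}
    (hφ : φ ∈ LinearMap.range (component K c i)) : component K c i φ = φ := by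
  obtain ⟨ψ, rfl⟩ := hφ
  exact LinearMap.congr_fun (H.component_mul_self i) ψ

lemma component_apply_eq_zero (H : IsHeckeChain K c N y) {i j : ℕ} (hij : i ≠ j) {φ : G → ℂ}
    (hφ : φ ∈ LinearMap.range (component K c j)) : component K c i φ = 0 := by
  obtain ⟨ψ, rfl⟩ := hφ
  exact LinearMap.congr_fun (H.component_mul_of_ne hij) ψ

/-- Equivariant endomorphisms act on each component by a scalar. -/
lemma exists_apply_eq_smul (H : IsHeckeChain K c N y) {A : Module.End ℂ (G → ℂ)}
    (hA : A ∈ equivariantEnd (K N) c) (i : Fin (N + 1)) :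
    ∃ a : ℂ, ∀ φ ∈ LinearMap.range (component K c i), A φ = a • φ := by
  obtain ⟨a, rfl⟩ := H.exists_eq_sum_component hA
  refine ⟨a i, fun φ hφ => ?_⟩
  rw [LinearMap.sum_apply, Finset.sum_eq_single i, LinearMap.smul_apply,
    H.component_apply_of_mem_range hφ]
  · intro j _ hj
    rw [LinearMap.smul_apply, H.component_apply_eq_zero (fun h => hj (Fin.ext h)) hφ, smul_zero]
  · simp

lemma rightTranslation_mem_range_component (K : ℕ → Subgroup G) (i : ℕ) (g : G) {φ : G → ℂ}
    (hφ : φ ∈ LinearMap.range (component K c i)) :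
    rightTranslation g φ ∈ LinearMap.range (component K c i) := by
  obtain ⟨ψ, rfl⟩ := hφ
  rw [← component_rightTranslation]
  exact LinearMap.mem_range_self _ _

lemma leftEquivariant_of_mem_range (H : IsHeckeChain K c N y) {i : ℕ} (hi : i ≤ N) {φ : G → ℂ}
    (hφ : φ ∈ LinearMap.range (component K c i)) : LeftEquivariant (K N) c φ := by
  obtain ⟨ψ, rfl⟩ := hφ
  rw [← H.proj_mul_component hi]
  exact leftEquivariant_proj (H.isCharOn_apply N) _

lemma range_inf_iSup_range (H : IsHeckeChain K c N y) (i : Fin (N + 1)) :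
    LinearMap.range (component K c i) ⊓
      (⨆ (j : Fin (N + 1)) (_ : j ≠ i), LinearMap.range (component K c j)) = ⊥ := by
  refine eq_bot_iff.2 fun φ ⟨h1, h2⟩ => ?_
  have hle : (⨆ (j : Fin (N + 1)) (_ : j ≠ i), LinearMap.range (component K c j)) ≤
      LinearMap.ker (component K c i) :=
    iSup₂_le fun j hj ψ hψ => H.component_apply_eq_zero (fun h => hj (Fin.ext h.symm)) hψ
  rw [Submodule.mem_bot, ← H.component_apply_of_mem_range h1]
  exact hle h2

lemma mem_iSup_range (H : IsHeckeChain K c N y) {φ : G → ℂ} (hφ : LeftEquivariant (K N) c φ) :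
    φ ∈ ⨆ i : Fin (N + 1), LinearMap.range (component K c i) := by
  rw [← proj_eq_self (H.isCharOn_apply N) hφ, ← sum_component, LinearMap.sum_apply]
  exact Submodule.sum_mem _ fun i _ =>
    Submodule.mem_iSup_of_mem i (LinearMap.mem_range_self _ _)

lemma eq_bot_or_eq_range (H : IsHeckeChain K c N y) (i : Fin (N + 1))
    (S : Submodule ℂ (G → ℂ)) (hS : S ≤ LinearMap.range (component K c i))
    (hinv : ∀ g, ∀ φ ∈ S, rightTranslation g φ ∈ S) :
    S = ⊥ ∨ S = LinearMap.range (component K c i) := by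
  obtain ⟨Q, hQ, hQS, hQid⟩ := exists_equivariant_projection S hinv
  have hA : Q * component K c i ∈ equivariantEnd (K N) c := by
    refine ⟨fun g => (hQ g).mul_left (commute_component_rightTranslation K i g), ?_, ?_⟩
    · exact LinearMap.ext fun φ => proj_eq_self (H.isCharOn_apply N)
        (H.leftEquivariant_of_mem_range (Fin.is_le i) (hS (hQS _)))
    · rw [mul_assoc, H.component_mul_proj (Fin.is_le i)]
  obtain ⟨a, ha⟩ := H.exists_apply_eq_smul hA i
  have ha' : ∀ φ ∈ LinearMap.range (component K c i), Q φ = a • φ := fun φ hφ => by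
    rw [← ha φ hφ, Module.End.mul_apply, H.component_apply_of_mem_range hφ]
  by_cases h0 : a = 0
  · refine Or.inl (eq_bot_iff.2 fun φ hφ => ?_)
    rw [Submodule.mem_bot, ← hQid φ hφ, ha' φ (hS hφ), h0, zero_smul]
  · refine Or.inr (le_antisymm hS fun φ hφ => ?_)
    have h := S.smul_mem a⁻¹ (hQS φ)
    rwa [ha' φ hφ, smul_smul, inv_mul_cancel₀ h0, one_smul] at h

lemma equivariant_map_eq_zero (H : IsHeckeChain K c N y) {i j : Fin (N + 1)} (hij : i ≠ j)
    (e : LinearMap.range (component K c i) →ₗ[ℂ] (G → ℂ))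
    (hmem : ∀ φ, e φ ∈ LinearMap.range (component K c j))
    (hequiv : ∀ (φ ψ : LinearMap.range (component K c i)) (g : G),
      (ψ : G → ℂ) = rightTranslation g (φ : G → ℂ) → e ψ = rightTranslation g (e φ)) :
    e = 0 := by
  have hA : e ∘ₗ (component K c i).rangeRestrict ∈ equivariantEnd (K N) c := by
    refine ⟨fun g => LinearMap.ext fun φ => hequiv _ _ g ?_, ?_, ?_⟩
    · exact component_rightTranslation K i g φ
    · exact LinearMap.ext fun φ => proj_eq_self (H.isCharOn_apply N)
        (H.leftEquivariant_of_mem_range (Fin.is_le j) (hmem _))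
    · refine LinearMap.ext fun φ => congrArg e (Subtype.ext ?_)
      change component K c i (proj (K N) c φ) = component K c i φ
      rw [← Module.End.mul_apply, H.component_mul_proj (Fin.is_le i)]
  obtain ⟨a, ha⟩ := H.exists_apply_eq_smul hA i
  refine LinearMap.ext fun φ => ?_
  have h1 : (component K c i).rangeRestrict φ = φ :=
    Subtype.ext (H.component_apply_of_mem_range φ.2)
  have h2 : e φ = a • (φ : G → ℂ) := by
    rw [← ha φ φ.2, LinearMap.comp_apply, h1]
  rw [LinearMap.zero_apply, ← H.component_apply_of_mem_range (hmem φ), h2, map_smul,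
    H.component_apply_eq_zero (fun h => hij (Fin.ext h.symm)) φ.2, smul_zero]

end IsHeckeChain

end Abstract

section Concrete

/-- The subgroup of matrices whose lower left entry is divisible by `t`. -/
def lowerDvd {R : Type*} [CommRing R] (t : R) : Subgroup (GL (Fin 2) R) where
  carrier := {g | t ∣ (g : Matrix (Fin 2) (Fin 2) R) 1 0}
  mul_mem' := by
    intro g h hg hh
    simp only [Set.mem_ofPred_eq, Units.val_mul, Matrix.mul_apply, Fin.sum_univ_two] at *
    exact dvd_add (hg.mul_right _) (hh.mul_left _)
  one_mem' := by simp
  inv_mem' := by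
    intro g hg
    simp only [Set.mem_ofPred_eq, Matrix.coe_units_inv, Matrix.inv_def, Matrix.adjugate_fin_two,
      Matrix.smul_apply, Matrix.of_apply, Matrix.cons_val', Matrix.cons_val_zero,
      Matrix.cons_val_one, Matrix.cons_val_fin_one, smul_eq_mul] at *
    exact (hg.neg_right).mul_left _

lemma mem_lowerDvd {R : Type*} [CommRing R] {t : R} {g : GL (Fin 2) R} :
    g ∈ lowerDvd t ↔ t ∣ (g : Matrix (Fin 2) (Fin 2) R) 1 0 := Iff.rfl

lemma chiB_eq {R : Type*} [CommRing R] (χ : Rˣ →* ℂˣ) {g : GL (Fin 2) R} {u : Rˣ}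
    (hu : (g : Matrix (Fin 2) (Fin 2) R) 1 1 = u) : chiB χ g = χ u := by
  have h : IsUnit ((g : Matrix (Fin 2) (Fin 2) R) 1 1) := hu ▸ u.isUnit
  rw [chiB, dif_pos h]
  congr 2
  exact Units.ext hu

lemma isUnit_det_entries {R : Type*} [CommRing R] (g : GL (Fin 2) R) :
    IsUnit (g 0 0 * g 1 1 - g 0 1 * g 1 0) := by
  rw [← Matrix.det_fin_two]
  exact (Matrix.isUnit_iff_isUnit_det _).1 g.isUnit

/-- The upper triangular matrix with diagonal entries `a`, `d` and upper right entry `b`. -/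
def upper {R : Type*} [CommRing R] (a d : Rˣ) (b : R) : GL (Fin 2) R :=
  Matrix.GeneralLinearGroup.mk'' !![(a : R), b; 0, (d : R)] (by simp [Matrix.det_fin_two])

lemma coe_upper {R : Type*} [CommRing R] (a d : Rˣ) (b : R) :
    (upper a d b : Matrix (Fin 2) (Fin 2) R) = !![(a : R), b; 0, (d : R)] := rfl

lemma coe_yG {R : Type*} [CommRing R] (t : R) :
    (yG t : Matrix (Fin 2) (Fin 2) R) = !![1, 0; t, 1] := rfl

lemma inB_upper {R : Type*} [CommRing R] (a d : Rˣ) (b : R) : inB (upper a d b) := by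
  simp [inB, coe_upper]

lemma chiB_upper {R : Type*} [CommRing R] (χ : Rˣ →* ℂˣ) (a d : Rˣ) (b : R) :
    chiB χ (upper a d b) = χ d :=
  chiB_eq χ (by simp [coe_upper])

/-- Matrices with equal bottom rows differ by an upper triangular factor on the left. -/
lemma inB_mul_inv {R : Type*} [CommRing R] {g h : GL (Fin 2) R} (h0 : g 1 0 = h 1 0)
    (h1 : g 1 1 = h 1 1) : inB (g * h⁻¹) := by
  have h2 : (h * h⁻¹ : GL (Fin 2) R) 1 0 = (0 : R) := by simp
  rw [Units.val_mul, Matrix.mul_apply, Fin.sum_univ_two] at h2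
  rw [inB, Units.val_mul, Matrix.mul_apply, Fin.sum_univ_two, h0, h1, h2]

variable {p n r : ℕ}

lemma exists_eq_pow_mul_unit [Fact p.Prime] (x : ZMod (p ^ n)) :
    ∃ j ≤ n, ∃ u : (ZMod (p ^ n))ˣ, x = (p : ZMod (p ^ n)) ^ j * u := by
  have hp : p.Prime := Fact.out
  have : NeZero (p ^ n) := ⟨pow_ne_zero _ hp.ne_zero⟩
  have hpn : (p : ZMod (p ^ n)) ^ n = 0 := by
    rw [← Nat.cast_pow, ZMod.natCast_self]
  by_cases hx : x = 0
  · exact ⟨n, le_rfl, 1, by rw [hx, hpn, zero_mul]⟩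
  have hval : x.val ≠ 0 := by rwa [Ne, ZMod.val_eq_zero]
  obtain ⟨j, m, hm, hjm⟩ := Nat.exists_eq_pow_mul_and_not_dvd hval p hp.ne_one
  have hxj : x = (p : ZMod (p ^ n)) ^ j * m := by
    rw [← ZMod.natCast_zmod_val x, hjm]
    push_cast
    rfl
  have hcop : m.Coprime (p ^ n) := ((hp.coprime_iff_not_dvd.2 hm).symm).pow_right n
  refine ⟨j, ?_, ZMod.unitOfCoprime m hcop, by rw [hxj, ZMod.coe_unitOfCoprime]⟩
  by_contra! hj
  refine hx ?_
  rw [hxj, ← Nat.sub_add_cancel hj.le, pow_add, hpn, mul_zero, zero_mul]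

lemma not_pow_succ_dvd_pow [Fact p.Prime] {m : ℕ} (hm : m < n) :
    ¬ (p : ZMod (p ^ n)) ^ (m + 1) ∣ (p : ZMod (p ^ n)) ^ m := by
  have hp : p.Prime := Fact.out
  rintro ⟨t, ht⟩
  have h : (p : ZMod (p ^ n)) ^ (n - 1) = 0 := by
    have h1 : n - 1 = n - 1 - m + m := by lia
    have h2 : n - 1 - m + (m + 1) = n := by lia
    rw [h1, pow_add, ht, ← mul_assoc, ← pow_add, h2, ← Nat.cast_pow, ZMod.natCast_self,
      zero_mul]
  rw [← Nat.cast_pow, ZMod.natCast_eq_zero_iff, Nat.pow_dvd_pow_iff_le_right hp.one_lt] at h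
  lia

lemma isNilpotent_of_pow_dvd (hr : 1 ≤ r) {x : ZMod (p ^ n)}
    (hx : (p : ZMod (p ^ n)) ^ r ∣ x) : IsNilpotent x := by
  refine ⟨n, ?_⟩
  obtain ⟨t, rfl⟩ := (dvd_pow_self (p : ZMod (p ^ n)) (by lia : r ≠ 0)).trans hx
  rw [mul_pow, ← Nat.cast_pow, ZMod.natCast_self, zero_mul]

lemma isUnit_of_mem_lowerDvd (hr : 1 ≤ r) {g : GL (Fin 2) (ZMod (p ^ n))}
    (hg : g ∈ lowerDvd ((p : ZMod (p ^ n)) ^ r)) : IsUnit (g 1 1) := by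
  have h1 : IsNilpotent (g 0 1 * g 1 0) := isNilpotent_of_pow_dvd hr (Dvd.dvd.mul_left hg _)
  have h2 := h1.isUnit_add_left_of_commute (isUnit_det_entries g) (Commute.all _ _)
  rw [sub_add_cancel] at h2
  exact isUnit_of_mul_isUnit_right h2

lemma isCharOn_chiB (hr : 1 ≤ r) {χ : (ZMod (p ^ n))ˣ →* ℂˣ} (hχ : hasConductor p n r χ) :
    IsCharOn (lowerDvd ((p : ZMod (p ^ n)) ^ r)) (chiB χ) := by
  refine ⟨by simpa using chiB_eq χ (g := 1) (u := 1) (by simp), fun g hg h hh => ?_⟩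
  obtain ⟨u, hu⟩ := isUnit_of_mem_lowerDvd hr hg
  obtain ⟨v, hv⟩ := isUnit_of_mem_lowerDvd hr hh
  obtain ⟨w, hw⟩ := isUnit_of_mem_lowerDvd hr (mul_mem hg hh)
  rw [chiB_eq χ hu.symm, chiB_eq χ hv.symm, chiB_eq χ hw.symm]
  have h1 : χ (w * (u * v)⁻¹) = 1 := by
    refine hχ.1 _ ?_
    have h2 : (w : ZMod (p ^ n)) = g 1 0 * h 0 1 + u * v := by
      rw [hw, hu, hv, Units.val_mul, Matrix.mul_apply, Fin.sum_univ_two]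
    have h3 : ((w * (u * v)⁻¹ : (ZMod (p ^ n))ˣ) : ZMod (p ^ n)) - 1 =
        g 1 0 * (h 0 1 * ((u * v)⁻¹ : (ZMod (p ^ n))ˣ)) := by
      have h4 : (u * v : ZMod (p ^ n)) * ((u * v)⁻¹ : (ZMod (p ^ n))ˣ) = 1 := by
        rw [← Units.val_mul, ← Units.val_mul, mul_inv_cancel, Units.val_one]
      rw [Units.val_mul, h2]
      linear_combination h4
    rw [h3]
    exact Dvd.dvd.mul_right hg _
  rw [map_mul, map_inv, mul_inv_eq_one] at h1
  rw [h1, map_mul, Units.val_mul]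

/-- Every matrix lies in one of the double cosets `B y(p^j) B`. -/
lemma exists_eq_mul_yG_mul [Fact p.Prime] (g : GL (Fin 2) (ZMod (p ^ n))) :
    ∃ j ≤ n, ∃ b b' : GL (Fin 2) (ZMod (p ^ n)), inB b ∧ inB b' ∧
      g = b * yG ((p : ZMod (p ^ n)) ^ j) * b' := by
  obtain ⟨j, hj, u, hu⟩ := exists_eq_pow_mul_unit (g 1 0)
  suffices h : ∃ (b : ZMod (p ^ n)) (d : (ZMod (p ^ n))ˣ),
      g 1 1 = (p : ZMod (p ^ n)) ^ j * b + d by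
    obtain ⟨b, d, hd⟩ := h
    refine ⟨j, hj, g * (yG ((p : ZMod (p ^ n)) ^ j) * upper u d b)⁻¹, upper u d b,
      inB_mul_inv ?_ ?_, inB_upper _ _ _, by group⟩
    · rw [hu, Units.val_mul, coe_yG, coe_upper]
      simp
    · rw [hd, Units.val_mul, coe_yG, coe_upper]
      simp
  rcases Nat.eq_zero_or_pos j with rfl | hj0
  · exact ⟨g 1 1 - 1, 1, by simp⟩
  · obtain ⟨d, hd⟩ := isUnit_of_mem_lowerDvd hj0 (mem_lowerDvd.2 (Dvd.intro _ hu.symm))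
    exact ⟨0, d, by rw [mul_zero, zero_add, hd]⟩

/-- The double coset of `y(p^j)` with `j < r` supports no bi-equivariant function. -/
lemma apply_yG_eq_zero {χ : (ZMod (p ^ n))ˣ →* ℂˣ} (hχ : hasConductor p n r χ)
    {f : GL (Fin 2) (ZMod (p ^ n)) → ℂ} (hl : ∀ b x, inB b → f (b * x) = chiB χ b * f x)
    (hr : ∀ b x, inB b → f (x * b) = chiB χ b * f x) {j : ℕ} (hj : j < r) :
    f (yG ((p : ZMod (p ^ n)) ^ j)) = 0 := by
  obtain ⟨u, hu, hχu⟩ := hχ.2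
  obtain ⟨w, hw⟩ := (pow_dvd_pow (p : ZMod (p ^ n)) (by lia : j ≤ r - 1)).trans hu
  have h1 : upper u 1 (-w) * yG ((p : ZMod (p ^ n)) ^ j) =
      yG ((p : ZMod (p ^ n)) ^ j) * upper 1 u (-w) := by
    apply Units.ext
    rw [Units.val_mul, Units.val_mul, coe_yG, coe_upper, coe_upper]
    ext i k
    fin_cases i <;> fin_cases k <;> simp
    · linear_combination hw
    · linear_combination -hw
  have h2 := hl (upper u 1 (-w)) (yG ((p : ZMod (p ^ n)) ^ j)) (inB_upper _ _ _)
  rw [h1, hr _ _ (inB_upper _ _ _), chiB_upper, chiB_upper, map_one, Units.val_one] at h2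
  have h3 : ((χ u : ℂ) - 1) * f (yG ((p : ZMod (p ^ n)) ^ j)) = 0 := by
    linear_combination h2
  refine (mul_eq_zero.1 h3).resolve_left fun h => hχu (Units.ext ?_)
  rw [Units.val_one, sub_eq_zero.1 h]

lemma mem_lowerDvd_pow_self {g : GL (Fin 2) (ZMod (p ^ n))} :
    g ∈ lowerDvd ((p : ZMod (p ^ n)) ^ n) ↔ inB g := by
  rw [mem_lowerDvd, ← Nat.cast_pow, ZMod.natCast_self, zero_dvd_iff, inB]

lemma isHeckeChain_lowerDvd [Fact p.Prime] (hr : 1 ≤ r) {N : ℕ} (hN : r + N = n)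
    {χ : (ZMod (p ^ n))ˣ →* ℂˣ} (hχ : hasConductor p n r χ) :
    IsHeckeChain (fun j => lowerDvd ((p : ZMod (p ^ n)) ^ (r + j))) (chiB χ) N
      (fun i => yG ((p : ZMod (p ^ n)) ^ (r + i.val))) where
  antitone i j hij g hg := (pow_dvd_pow _ (by lia)).trans hg
  isCharOn := isCharOn_chiB hr hχ
  strict j hj := by
    refine ⟨yG ((p : ZMod (p ^ n)) ^ (r + j)), ?_, fun h => ?_⟩
    · simp [mem_lowerDvd, coe_yG]
    · refine not_pow_succ_dvd_pow (p := p) (n := n) (m := r + j) (by lia) ?_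
      simpa [mem_lowerDvd, coe_yG, add_assoc] using h
  eq_zero f hl hrt h0 := by
    simp only [LeftEquivariant, hN, mem_lowerDvd_pow_self] at hl hrt
    ext x
    obtain ⟨j, hj, b, b', hb, hb', rfl⟩ := exists_eq_mul_yG_mul x
    rw [hrt _ hb', hl _ hb]
    have h1 : f (yG ((p : ZMod (p ^ n)) ^ j)) = 0 := by
      rcases lt_or_ge j r with hjr | hjr
      · exact apply_yG_eq_zero hχ (fun b x hb => hl b hb x) (fun b x hb => hrt b hb x) hjr
      · have h2 := h0 ⟨j - r, by lia⟩
        rwa [show r + (j - r) = j by lia] at h2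
    simp [h1]

end Concrete

end HeckeChain

/-- `I(n)` is the internal direct sum of `n+1−r` irreducible, pairwise non-isomorphic,
`G`-invariant subspaces: `I(n)` is multiplicity free with exactly `n+1−r` irreducible
constituents. -/
theorem stmt11 (p n r : ℕ) [Fact p.Prime] (hn : 1 ≤ n) (hr : 1 ≤ r) (hrn : r ≤ n)
    (χ : (ZMod (p ^ n))ˣ →* ℂˣ) (hχ : hasConductor p n r χ) :
    ∃ T : Fin (n + 1 - r) → Submodule ℂ (GL (Fin 2) (ZMod (p ^ n)) → ℂ),
      (∀ i, T i ≤ Isub p n χ) ∧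
      (∀ i, invariant p n (T i)) ∧
      (∀ i, T i ≠ ⊥) ∧
      (∀ i, T i ⊓ (⨆ (j) (_ : j ≠ i), T j) = ⊥) ∧
      (⨆ i, T i) = Isub p n χ ∧
      (∀ i (S : Submodule ℂ (GL (Fin 2) (ZMod (p ^ n)) → ℂ)),
        S ≤ T i → invariant p n S → S = ⊥ ∨ S = T i) ∧
      (∀ i j, i ≠ j →
        ¬ ∃ e : T i →ₗ[ℂ] (GL (Fin 2) (ZMod (p ^ n)) → ℂ),
            Function.Injective e ∧
            Set.range (fun ψ : T i => e ψ) = (T j : Set (GL (Fin 2) (ZMod (p ^ n)) → ℂ)) ∧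
            ∀ (φ ψ : T i) (g : GL (Fin 2) (ZMod (p ^ n))),
              (ψ : GL (Fin 2) (ZMod (p ^ n)) → ℂ) =
                  (fun x => (φ : GL (Fin 2) (ZMod (p ^ n)) → ℂ) (x * g)) →
              e ψ = fun x => e φ (x * g)) := by
  obtain ⟨N, hN⟩ := Nat.exists_eq_add_of_le hrn
  have hk : n + 1 - r = N + 1 := by lia
  have : NeZero (p ^ n) := ⟨pow_ne_zero _ (Fact.out : p.Prime).ne_zero⟩
  have H := HeckeChain.isHeckeChain_lowerDvd hr hN.symm hχ
  have hI : ∀ φ, HeckeChain.LeftEquivariant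
      (HeckeChain.lowerDvd ((p : ZMod (p ^ n)) ^ (r + N))) (chiB χ) φ ↔ φ ∈ Isub p n χ := by
    intro φ
    rw [← hN]
    exact ⟨fun h b x hb => h b (HeckeChain.mem_lowerDvd_pow_self.2 hb) x,
      fun h b hb x => h b x (HeckeChain.mem_lowerDvd_pow_self.1 hb)⟩
  rw [hk]
  set E := HeckeChain.component (fun j => HeckeChain.lowerDvd ((p : ZMod (p ^ n)) ^ (r + j)))
    (chiB χ)
  have hle : ∀ i : Fin (N + 1), LinearMap.range (E i) ≤ Isub p n χ := fun i φ hφ =>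
    (hI φ).1 (H.leftEquivariant_of_mem_range (Fin.is_le i) hφ)
  have hne : ∀ i : Fin (N + 1), LinearMap.range (E i) ≠ ⊥ := fun i h =>
    H.component_ne_zero (Fin.is_le i) (LinearMap.range_eq_bot.1 h)
  refine ⟨fun i => LinearMap.range (E i), hle, ?_, hne, H.range_inf_iSup_range,
    le_antisymm (iSup_le hle) fun φ hφ => H.mem_iSup_range ((hI φ).2 hφ),
    fun i S hS hinv => H.eq_bot_or_eq_range i S hS hinv, ?_⟩
  · exact fun i g φ hφ =>
      HeckeChain.IsHeckeChain.rightTranslation_mem_range_component _ i g hφ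
  · rintro i j hij ⟨e, hinj, hrange, hequiv⟩
    have h0 : e = 0 := H.equivariant_map_eq_zero hij e
      (fun φ => by
        have h : e φ ∈ Set.range fun ψ : LinearMap.range (E i) => e ψ := ⟨φ, rfl⟩
        rwa [hrange] at h) hequiv
    obtain ⟨φ, hφ, hφ0⟩ := (Submodule.ne_bot_iff _).1 (hne i)
    have h1 : (⟨φ, hφ⟩ : LinearMap.range (E i)) = 0 := hinj (by simp [h0])
    exact hφ0 (congrArg Subtype.val h1)

end
end

section
/- For each k with r ≤ k ≤ n there exists an irreducible complex representation σ(k) of G, unique up to isomorphism, such that: σ(k) contains a nonzero (χ,B_k)-fixed vector, and, if k > r, σ(k) contains no nonzero (χ,B_{k−1})-fixed vector (for k = r, σ(r) is the unique irreducible representation of G, up to isomorphism, containing a nonzero (χ,B_r)-fixed vector). Moreover the (χ,B_k)-fixed vector of σ(k) is unique up to scalar multiples, dim σ(r) = p^{r−1}(p+1), and dim σ(k) = p^{k−2}(p²−1) for r < k ≤ n. -/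
noncomputable section

/-- Membership in `B_k = {g ∈ G : the (2,1)-entry of g lies in p^k·(ℤ/pⁿℤ)}`. -/
def inBk (p n k : ℕ) (g : GL (Fin 2) (ZMod (p ^ n))) : Prop :=
  (p : ZMod (p ^ n)) ^ k ∣ (g : Matrix (Fin 2) (Fin 2) (ZMod (p ^ n))) 1 0

/-- A complex representation of a group `G`. -/
structure RepOn (G : Type*) [Group G] where
  carrier : Type
  [acg : AddCommGroup carrier]
  [mod : Module ℂ carrier]
  ρ : Representation ℂ G carrier

attribute [instance] RepOn.acg RepOn.mod

/-- Irreducibility: the representation is nonzero and has no invariant subspaces other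
than `0` and the whole space. -/
def isIrredOn {G : Type*} [Group G] (W : RepOn G) : Prop :=
  (∃ v : W.carrier, v ≠ 0) ∧
  ∀ S : Submodule ℂ W.carrier, (∀ g : G, ∀ v ∈ S, W.ρ g v ∈ S) → S = ⊥ ∨ S = ⊤

/-- `v` is a `(χ,B_k)`-fixed vector: `ρ(b)v = χ_{B_k}(b)·v` for all `b ∈ B_k`. -/
def isFixedVec (p n k : ℕ) (χ : (ZMod (p ^ n))ˣ →* ℂˣ)
    (W : RepOn (GL (Fin 2) (ZMod (p ^ n)))) (v : W.carrier) : Prop :=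
  ∀ b : GL (Fin 2) (ZMod (p ^ n)), inBk p n k b → W.ρ b v = chiB χ b • v

/-- The defining property of `σ(k)`: irreducible, has a nonzero `(χ,B_k)`-fixed vector,
and (if `k > r`) no nonzero `(χ,B_{k−1})`-fixed vector. -/
def sigmaProp (p n r k : ℕ) (χ : (ZMod (p ^ n))ˣ →* ℂˣ)
    (W : RepOn (GL (Fin 2) (ZMod (p ^ n)))) : Prop :=
  isIrredOn W ∧
  (∃ v : W.carrier, v ≠ 0 ∧ isFixedVec p n k χ W v) ∧
  (r < k → ¬ ∃ v : W.carrier, v ≠ 0 ∧ isFixedVec p n (k - 1) χ W v)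

/-! ### Functions equivariant under a character of a subgroup -/

section Induced

variable {G : Type*} [Group G]

/-- `ψ` restricts to a multiplicative character of the subgroup `H`. -/
structure IsCharOn (H : Subgroup G) (ψ : G → ℂ) : Prop where
  map_one : ψ 1 = 1
  map_mul : ∀ a ∈ H, ∀ b ∈ H, ψ (a * b) = ψ a * ψ b

theorem IsCharOn.mul_inv {H : Subgroup G} {ψ : G → ℂ} (hψ : IsCharOn H ψ) {a : G}
    (ha : a ∈ H) : ψ a * ψ a⁻¹ = 1 := by
  rw [← hψ.map_mul a ha _ (H.inv_mem ha), mul_inv_cancel, hψ.map_one]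

/-- The right regular representation on functions. -/
def rightReg (G : Type*) [Group G] : Representation ℂ G (G → ℂ) where
  toFun g := LinearMap.funLeft ℂ ℂ (fun x => x * g)
  map_one' := by ext f x; simp [LinearMap.funLeft]
  map_mul' g h := by ext f x; simp [LinearMap.funLeft, mul_assoc]

@[simp]
theorem rightReg_apply (g : G) (f : G → ℂ) (x : G) : rightReg G g f x = f (x * g) := rfl

/-- The space of the induced representation: functions with `f (h x) = ψ h * f x` for `h ∈ H`. -/
def equivFns (H : Subgroup G) (ψ : G → ℂ) : Submodule ℂ (G → ℂ) where
  carrier := {f | ∀ h ∈ H, ∀ x, f (h * x) = ψ h * f x}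
  zero_mem' := by intro h _ x; simp
  add_mem' := by
    intro f g hf hg h hh x
    simp [hf h hh x, hg h hh x, mul_add]
  smul_mem' := by
    intro c f hf h hh x
    simp only [Pi.smul_apply, smul_eq_mul, hf h hh x]
    ring

theorem rightReg_mem_equivFns {H : Subgroup G} {ψ : G → ℂ} {f : G → ℂ}
    (hf : f ∈ equivFns H ψ) (g : G) : rightReg G g f ∈ equivFns H ψ := by
  intro h hh x
  simp [mul_assoc, hf h hh]

theorem equivFns_mono {H K : Subgroup G} (ψ : G → ℂ) (h : H ≤ K) :
    equivFns K ψ ≤ equivFns H ψ :=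
  fun _ hf a ha x => hf a (h ha) x

open Classical in
/-- The function equal to `ψ` on `H` and to `0` elsewhere. -/
def extendZero (H : Subgroup G) (ψ : G → ℂ) (x : G) : ℂ := if x ∈ H then ψ x else 0

theorem extendZero_mem_equivFns {H : Subgroup G} {ψ : G → ℂ} (hψ : IsCharOn H ψ) :
    extendZero H ψ ∈ equivFns H ψ := by
  intro h hh x
  by_cases hx : x ∈ H
  · simp [extendZero, hx, H.mul_mem hh hx, hψ.map_mul h hh x hx]
  · simp [extendZero, hx, H.mul_mem_cancel_left hh]

/-- `f` is an eigenvector of `H` with character `ψ` for the right regular representation. -/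
def IsRightFixed (H : Subgroup G) (ψ : G → ℂ) (f : G → ℂ) : Prop :=
  ∀ h ∈ H, ∀ x, f (x * h) = ψ h * f x

theorem isRightFixed_extendZero {H : Subgroup G} {ψ : G → ℂ} (hψ : IsCharOn H ψ) :
    IsRightFixed H ψ (extendZero H ψ) := by
  intro h hh x
  by_cases hx : x ∈ H
  · simp [extendZero, hx, H.mul_mem hx hh, hψ.map_mul x hx h hh, mul_comm]
  · simp [extendZero, hx, H.mul_mem_cancel_right hh]

/-- The dimension of the induced representation is the number of coset representatives. -/
theorem finrank_equivFns {ι : Type*} [Fintype ι] {H : Subgroup G} {ψ : G → ℂ}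
    (hψ : IsCharOn H ψ) (rep : ι → G) (hinj : ∀ i j, rep j * (rep i)⁻¹ ∈ H → i = j)
    (hsurj : ∀ x, ∃ i, x * (rep i)⁻¹ ∈ H) :
    Module.finrank ℂ (equivFns H ψ) = Fintype.card ι := by
  classical
  let T : equivFns H ψ →ₗ[ℂ] (ι → ℂ) :=
    (LinearMap.funLeft ℂ ℂ rep).comp (equivFns H ψ).subtype
  have hT (f : equivFns H ψ) (i : ι) : T f i = f.1 (rep i) := rfl
  have hTinj : Function.Injective T := by
    rw [injective_iff_map_eq_zero]
    intro f hf
    ext x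
    obtain ⟨i, hi⟩ := hsurj x
    have h1 := f.2 _ hi (rep i)
    rw [← hT, hf] at h1
    simpa using h1
  have hTsurj : Function.Surjective T := by
    intro φ
    refine ⟨∑ i, φ i • ⟨_, rightReg_mem_equivFns (extendZero_mem_equivFns hψ) (rep i)⁻¹⟩, ?_⟩
    ext j
    have h0 (i : ι) : extendZero H ψ (rep j * (rep i)⁻¹) = if i = j then 1 else 0 := by
      split_ifs with h
      · subst h
        simp [extendZero, hψ.map_one, H.one_mem]
      · rw [extendZero, if_neg (fun hh => h (hinj i j hh))]
    rw [hT]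
    simp [h0]
  rw [(LinearEquiv.ofBijective T ⟨hTinj, hTsurj⟩).finrank_eq, Module.finrank_fintype_fun_eq_card]

/-- `Q` is an intertwining projection of `equivFns H ψ` onto `U`. -/
structure IsProjOnto (H : Subgroup G) (ψ : G → ℂ) (U : Submodule ℂ (G → ℂ))
    (Q : (G → ℂ) →ₗ[ℂ] (G → ℂ)) : Prop where
  le : U ≤ equivFns H ψ
  comm : ∀ g f, Q (rightReg G g f) = rightReg G g (Q f)
  mem : ∀ f ∈ equivFns H ψ, Q f ∈ U
  eq_self : ∀ f ∈ U, Q f = f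

theorem isProjOnto_id (H : Subgroup G) (ψ : G → ℂ) :
    IsProjOnto H ψ (equivFns H ψ) LinearMap.id :=
  ⟨le_rfl, fun _ _ => rfl, fun _ h => h, fun _ _ => rfl⟩

section Proj

variable {H : Subgroup G} {ψ : G → ℂ} {U : Submodule ℂ (G → ℂ)} {Q : (G → ℂ) →ₗ[ℂ] (G → ℂ)}

theorem IsProjOnto.rightReg_mem (hQ : IsProjOnto H ψ U Q) (g : G) {f : G → ℂ} (hf : f ∈ U) :
    rightReg G g f ∈ U := by
  rw [← hQ.eq_self f hf, ← hQ.comm]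
  exact hQ.mem _ (rightReg_mem_equivFns (hQ.le hf) g)

/-- An intertwining projection preserves fixed functions. -/
theorem IsProjOnto.isRightFixed (hQ : IsProjOnto H ψ U Q) {f : G → ℂ}
    (hf : IsRightFixed H ψ f) : IsRightFixed H ψ (Q f) := by
  intro h hh x
  have h1 : rightReg G h f = ψ h • f := by
    ext y
    exact hf h hh y
  have h2 := congrFun (hQ.comm h f) x
  rw [h1, map_smul] at h2
  exact h2.symm

/-- The representation on `U` by right translations. -/
def IsProjOnto.rep (hQ : IsProjOnto H ψ U Q) : Representation ℂ G U where
  toFun g := (rightReg G g).restrict fun _ hf => hQ.rightReg_mem g hf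
  map_one' := by
    ext f
    simp
  map_mul' g h := by
    ext f
    simp [mul_assoc]

end Proj

variable [Fintype G]

open Classical in
/-- The projection of functions on `G` onto `equivFns H ψ`. -/
def leftAvg (H : Subgroup G) (ψ : G → ℂ) : (G → ℂ) →ₗ[ℂ] (G → ℂ) where
  toFun f x := (Fintype.card H : ℂ)⁻¹ * ∑ h : H, ψ (h : G)⁻¹ * f (h * x)
  map_add' f g := by
    ext x
    simp [mul_add, Finset.sum_add_distrib]
  map_smul' c f := by
    ext x
    simp only [Pi.smul_apply, smul_eq_mul, RingHom.id_apply, Finset.mul_sum]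
    exact Finset.sum_congr rfl fun _ _ => by ring

open Classical in
theorem leftAvg_apply (H : Subgroup G) (ψ : G → ℂ) (f : G → ℂ) (x : G) :
    leftAvg H ψ f x = (Fintype.card H : ℂ)⁻¹ * ∑ h : H, ψ (h : G)⁻¹ * f (h * x) := rfl

theorem leftAvg_rightReg (H : Subgroup G) (ψ : G → ℂ) (g : G) (f : G → ℂ) :
    leftAvg H ψ (rightReg G g f) = rightReg G g (leftAvg H ψ f) := by
  ext x
  simp [leftAvg_apply, mul_assoc]

theorem leftAvg_mem {H : Subgroup G} {ψ : G → ℂ} (hψ : IsCharOn H ψ) (f : G → ℂ) :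
    leftAvg H ψ f ∈ equivFns H ψ := by
  classical
  intro a ha x
  rw [leftAvg_apply, leftAvg_apply, mul_left_comm]
  congr 1
  rw [Finset.mul_sum]
  refine Fintype.sum_equiv (Equiv.mulRight (⟨a, ha⟩ : H)) _ _ fun h => ?_
  have h1 : ψ (a⁻¹ * (h : G)⁻¹) = ψ a⁻¹ * ψ (h : G)⁻¹ :=
    hψ.map_mul _ (H.inv_mem ha) _ (H.inv_mem h.2)
  simp only [Equiv.coe_mulRight, Subgroup.coe_mul, mul_inv_rev, h1, mul_assoc]
  rw [← mul_assoc (ψ a), hψ.mul_inv ha, one_mul]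

theorem leftAvg_eq_self {H : Subgroup G} {ψ : G → ℂ} (hψ : IsCharOn H ψ) {f : G → ℂ}
    (hf : f ∈ equivFns H ψ) : leftAvg H ψ f = f := by
  classical
  ext x
  have h1 (h : H) : ψ (h : G)⁻¹ * f (h * x) = f x := by
    rw [hf h h.2, ← mul_assoc, mul_comm (ψ _), hψ.mul_inv h.2, one_mul]
  rw [leftAvg_apply, Finset.sum_congr rfl fun h _ => h1 h, Finset.sum_const, Finset.card_univ,
    nsmul_eq_mul, inv_mul_cancel_left₀ (by simp)]

theorem leftAvg_apply_one {H : Subgroup G} {ψ : G → ℂ} (hψ : IsCharOn H ψ) {f : G → ℂ}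
    (hf : IsRightFixed H ψ f) : leftAvg H ψ f 1 = f 1 := by
  classical
  have h1 (h : H) : ψ (h : G)⁻¹ * f (h * 1) = f 1 := by
    rw [mul_one, ← one_mul (h : G), hf h h.2, one_mul, ← mul_assoc, mul_comm (ψ _),
      hψ.mul_inv h.2, one_mul]
  rw [leftAvg_apply, Finset.sum_congr rfl fun h _ => h1 h, Finset.sum_const, Finset.card_univ,
    nsmul_eq_mul, inv_mul_cancel_left₀ (by simp)]

/-- The kernel of `leftAvg K ψ` in `equivFns H ψ` has complementary dimension. -/
theorem finrank_inf_ker_leftAvg {H K : Subgroup G} {ψ : G → ℂ} (hψ : IsCharOn K ψ) (h : H ≤ K) :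
    Module.finrank ℂ ↥(equivFns H ψ ⊓ LinearMap.ker (leftAvg K ψ)) +
      Module.finrank ℂ (equivFns K ψ) = Module.finrank ℂ (equivFns H ψ) := by
  have h1 : equivFns H ψ ⊓ LinearMap.ker (leftAvg K ψ) ⊔ equivFns K ψ = equivFns H ψ := by
    refine le_antisymm (sup_le inf_le_left (equivFns_mono ψ h)) fun f hf => ?_
    rw [← sub_add_cancel f (leftAvg K ψ f)]
    refine Submodule.add_mem_sup ⟨?_, ?_⟩ (leftAvg_mem hψ f)
    · exact Submodule.sub_mem _ hf (equivFns_mono ψ h (leftAvg_mem hψ f))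
    · rw [SetLike.mem_coe, LinearMap.mem_ker, map_sub, leftAvg_eq_self hψ (leftAvg_mem hψ f),
        sub_self]
  have h2 : equivFns H ψ ⊓ LinearMap.ker (leftAvg K ψ) ⊓ equivFns K ψ = ⊥ := by
    rw [eq_bot_iff]
    rintro f ⟨⟨-, hf⟩, hf'⟩
    rw [SetLike.mem_coe, LinearMap.mem_ker, leftAvg_eq_self hψ hf'] at hf
    exact hf
  have h3 := Submodule.finrank_sup_add_finrank_inf_eq
    (equivFns H ψ ⊓ LinearMap.ker (leftAvg K ψ)) (equivFns K ψ)
  rw [h1, h2, finrank_bot, add_zero] at h3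
  exact h3.symm

/-- Any nonzero invariant space of equivariant functions contains an `H`-fixed function not
vanishing at `1`. -/
theorem exists_isRightFixed {H : Subgroup G} {ψ : G → ℂ} (hψ : IsCharOn H ψ)
    {S : Submodule ℂ (G → ℂ)} (hS : S ≤ equivFns H ψ)
    (hinv : ∀ g, ∀ f ∈ S, rightReg G g f ∈ S) (hne : S ≠ ⊥) :
    ∃ f ∈ S, IsRightFixed H ψ f ∧ f 1 ≠ 0 := by
  classical
  obtain ⟨f, hfS, hf⟩ := (Submodule.ne_bot_iff _).1 hne
  obtain ⟨x, hx⟩ := Function.ne_iff.1 hf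
  refine ⟨∑ h : H, ψ (h : G)⁻¹ • rightReg G (h : G) (rightReg G x f),
    Submodule.sum_mem _ fun h _ => S.smul_mem _ (hinv _ _ (hinv _ _ hfS)), ?_, ?_⟩
  · intro a ha y
    simp only [Finset.sum_apply, Pi.smul_apply, rightReg_apply, smul_eq_mul, Finset.mul_sum]
    refine Fintype.sum_equiv (Equiv.mulLeft (⟨a, ha⟩ : H)) _ _ fun h => ?_
    have h1 : ψ ((h : G)⁻¹ * a⁻¹) = ψ (h : G)⁻¹ * ψ a⁻¹ :=
      hψ.map_mul _ (H.inv_mem h.2) _ (H.inv_mem ha)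
    simp only [Equiv.coe_mulLeft, Subgroup.coe_mul, mul_inv_rev, h1, mul_assoc]
    rw [mul_left_comm (ψ a), ← mul_assoc (ψ a), hψ.mul_inv ha, one_mul]
  · have h2 (h : H) : ψ (h : G)⁻¹ * f (h * x) = f x := by
      rw [hS hfS h h.2, ← mul_assoc, mul_comm (ψ _), hψ.mul_inv h.2, one_mul]
    simpa [h2] using hx

/-- Expansion of an equivariant function in translates of `extendZero H ψ`. -/
theorem sum_smul_rightReg_extendZero {H : Subgroup G} {ψ : G → ℂ} {f : G → ℂ}
    (hf : f ∈ equivFns H ψ) :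
    ∑ g, f g • rightReg G g⁻¹ (extendZero H ψ) = (Nat.card H : ℂ) • f := by
  classical
  ext x
  simp only [Finset.sum_apply, Pi.smul_apply, rightReg_apply, smul_eq_mul]
  have h1 : ∑ g, f g * extendZero H ψ (x * g⁻¹) = ∑ g : G, if g ∈ H then f x else 0 := by
    refine Fintype.sum_equiv ((Equiv.inv G).trans (Equiv.mulLeft x)) _ _ fun g => ?_
    simp only [Equiv.trans_apply, Equiv.inv_apply, Equiv.coe_mulLeft, extendZero]
    split_ifs with h
    · have h2 := hf _ h g
      rw [inv_mul_cancel_right] at h2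
      rw [h2, mul_comm]
    · simp
  rw [h1, ← Finset.sum_filter, Finset.sum_const, nsmul_eq_mul, Nat.card_eq_fintype_card,
    Fintype.card_subtype]

/-- A vector `v` of a representation gives an intertwining map from functions on `G`. -/
def fromFns {V : Type*} [AddCommGroup V] [Module ℂ V] (ρ : Representation ℂ G V) (v : V) :
    (G → ℂ) →ₗ[ℂ] V where
  toFun f := ∑ g, f g • ρ g⁻¹ v
  map_add' f g := by simp [add_smul, Finset.sum_add_distrib]
  map_smul' c f := by simp [Finset.smul_sum, mul_smul]

section FromFns

variable {V : Type*} [AddCommGroup V] [Module ℂ V] (ρ : Representation ℂ G V)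

theorem fromFns_apply (v : V) (f : G → ℂ) : fromFns ρ v f = ∑ g, f g • ρ g⁻¹ v := rfl

theorem fromFns_rightReg (v : V) (g : G) (f : G → ℂ) :
    fromFns ρ v (rightReg G g f) = ρ g (fromFns ρ v f) := by
  rw [fromFns_apply, fromFns_apply, map_sum]
  refine Fintype.sum_equiv (Equiv.mulRight g) _ _ fun x => ?_
  simp only [rightReg_apply, Equiv.coe_mulRight, map_smul, mul_inv_rev]
  rw [map_mul, Module.End.mul_apply, ← Module.End.mul_apply (ρ g) (ρ g⁻¹), ← map_mul,
    mul_inv_cancel, map_one, Module.End.one_apply]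

theorem fromFns_extendZero {H : Subgroup G} {ψ : G → ℂ} (hψ : IsCharOn H ψ) {v : V}
    (hv : ∀ h ∈ H, ρ h v = ψ h • v) :
    fromFns ρ v (extendZero H ψ) = (Nat.card H : ℂ) • v := by
  classical
  have h1 (g : G) : extendZero H ψ g • ρ g⁻¹ v = if g ∈ H then v else 0 := by
    unfold extendZero
    split_ifs with h
    · rw [hv _ (H.inv_mem h), smul_smul, hψ.mul_inv h, one_smul]
    · simp
  rw [fromFns_apply, Finset.sum_congr rfl fun g _ => h1 g, ← Finset.sum_filter,
    Finset.sum_const, Nat.card_eq_fintype_card, Fintype.card_subtype, Nat.cast_smul_eq_nsmul]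

theorem fromFns_eq_zero {K : Subgroup G} {ψ : G → ℂ} (hψ : IsCharOn K ψ)
    (hK : ∀ w, (∀ h ∈ K, ρ h w = ψ h • w) → w = 0) (v : V) {f : G → ℂ}
    (hf : f ∈ equivFns K ψ) : fromFns ρ v f = 0 := by
  classical
  have h0 : ∑ h : K, ψ h • ρ (h : G)⁻¹ v = 0 := by
    apply hK
    intro a ha
    rw [map_sum, Finset.smul_sum]
    refine Fintype.sum_equiv (Equiv.mulRight (⟨a, ha⟩ : K)⁻¹) _ _ fun h => ?_
    have h1 : ψ ((h : G) * a⁻¹) = ψ h * ψ a⁻¹ := hψ.map_mul _ h.2 _ (K.inv_mem ha)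
    simp only [Equiv.coe_mulRight, Subgroup.coe_mul, Subgroup.coe_inv, mul_inv_rev, inv_inv, h1,
      map_smul, smul_smul, map_mul, Module.End.mul_apply]
    rw [mul_left_comm, hψ.mul_inv ha, mul_one]
  have h1 (h : K) : fromFns ρ v f = ∑ g, f g • ρ g⁻¹ (ψ h • ρ (h : G)⁻¹ v) := by
    rw [fromFns_apply]
    refine (Fintype.sum_equiv (Equiv.mulLeft (h : G)) _ _ fun g => ?_).symm
    simp only [Equiv.coe_mulLeft, hf h h.2, mul_inv_rev, map_mul, Module.End.mul_apply, map_smul,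
      smul_smul]
    rw [mul_comm]
  have h2 : ∑ _h : K, fromFns ρ v f = 0 := by
    rw [Finset.sum_congr rfl fun h _ => h1 h, Finset.sum_comm]
    simp only [← Finset.smul_sum, ← map_sum, h0, map_zero, smul_zero, Finset.sum_const_zero]
  rw [Finset.sum_const, ← Nat.cast_smul_eq_nsmul ℂ, smul_eq_zero] at h2
  exact h2.resolve_left (by simp)

end FromFns

theorem isProjOnto_sub_leftAvg {H K : Subgroup G} {ψ : G → ℂ} (hψ : IsCharOn K ψ) (h : H ≤ K) :
    IsProjOnto H ψ (equivFns H ψ ⊓ LinearMap.ker (leftAvg K ψ))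
      (LinearMap.id - leftAvg K ψ) where
  le := inf_le_left
  comm g f := by
    rw [LinearMap.sub_apply, LinearMap.sub_apply, leftAvg_rightReg, map_sub, LinearMap.id_apply,
      LinearMap.id_apply]
  mem f hf := by
    refine ⟨Submodule.sub_mem _ hf (equivFns_mono ψ h (leftAvg_mem hψ f)), ?_⟩
    rw [SetLike.mem_coe, LinearMap.mem_ker, LinearMap.sub_apply, map_sub, LinearMap.id_apply,
      leftAvg_eq_self hψ (leftAvg_mem hψ f), sub_self]
  eq_self f hf := by
    rw [LinearMap.sub_apply, LinearMap.mem_ker.1 hf.2, sub_zero, LinearMap.id_apply]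

/-- If fixed functions in `U` are determined by their value at `1`, then `U` is irreducible. -/
theorem IsProjOnto.eq_bot_or_eq {H : Subgroup G} {ψ : G → ℂ} {U : Submodule ℂ (G → ℂ)}
    {Q : (G → ℂ) →ₗ[ℂ] (G → ℂ)} (hψ : IsCharOn H ψ) (hQ : IsProjOnto H ψ U Q)
    (hU : ∀ f ∈ U, IsRightFixed H ψ f → f 1 = 0 → f = 0) {S : Submodule ℂ (G → ℂ)}
    (hSU : S ≤ U) (hinv : ∀ g, ∀ f ∈ S, rightReg G g f ∈ S) : S = ⊥ ∨ S = U := by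
  refine or_iff_not_imp_left.2 fun hne => le_antisymm hSU fun f hf => ?_
  obtain ⟨f₀, hf₀S, hf₀, hf₀1⟩ := exists_isRightFixed hψ (hSU.trans hQ.le) hinv hne
  have he : Q (extendZero H ψ) ∈ S := by
    set e := Q (extendZero H ψ)
    have h1 : e - (e 1 / f₀ 1) • f₀ = 0 := by
      refine hU _ (U.sub_mem (hQ.mem _ (extendZero_mem_equivFns hψ))
        (U.smul_mem _ (hSU hf₀S))) ?_ ?_
      · intro h hh x
        simp only [Pi.sub_apply, Pi.smul_apply, smul_eq_mul, hf₀ h hh x,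
          hQ.isRightFixed (isRightFixed_extendZero hψ) h hh x, e]
        ring
      · simp [hf₀1]
    rw [sub_eq_zero.1 h1]
    exact S.smul_mem _ hf₀S
  have h2 := congrArg Q (sum_smul_rightReg_extendZero (hQ.le hf))
  rw [map_smul, hQ.eq_self f hf, map_sum] at h2
  rw [← S.smul_mem_iff (s := (Nat.card H : ℂ)) (Nat.cast_ne_zero.2 Nat.card_pos.ne'), ← h2]
  refine S.sum_mem fun g _ => ?_
  rw [map_smul, hQ.comm]
  exact S.smul_mem _ (hinv _ _ he)

end Induced

section RepOn

variable {G : Type} [Group G] [Fintype G] {H : Subgroup G} {ψ : G → ℂ}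
  {U : Submodule ℂ (G → ℂ)} {Q : (G → ℂ) →ₗ[ℂ] (G → ℂ)}

/-- The bundled form of `IsProjOnto.rep`. -/
def IsProjOnto.repOn (hQ : IsProjOnto H ψ U Q) : RepOn G := ⟨U, hQ.rep⟩

theorem IsProjOnto.isIrredOn_repOn (hψ : IsCharOn H ψ) (hQ : IsProjOnto H ψ U Q)
    (hU : ∀ f ∈ U, IsRightFixed H ψ f → f 1 = 0 → f = 0) (hne : U ≠ ⊥) :
    isIrredOn hQ.repOn := by
  constructor
  · obtain ⟨f, hf, hf0⟩ := (Submodule.ne_bot_iff _).1 hne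
    exact ⟨⟨f, hf⟩, fun h => hf0 (congrArg Subtype.val h)⟩
  · intro (S : Submodule ℂ U) hS
    have h1 := hQ.eq_bot_or_eq hψ hU (S := S.map U.subtype) (Submodule.map_subtype_le U S) (by
      rintro g _ ⟨f, hf, rfl⟩
      exact ⟨hQ.rep g f, hS g f hf, rfl⟩)
    refine h1.imp (fun h => ?_) (fun h => ?_)
    · exact (Submodule.map_injective_of_injective U.injective_subtype)
        (h.trans (Submodule.map_bot _).symm)
    · exact (Submodule.map_injective_of_injective U.injective_subtype)
        (h.trans (Submodule.map_subtype_top U).symm)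

/-- An irreducible representation with an `H`-fixed vector is isomorphic to `U`, provided that the
corresponding intertwining map factors through `Q`. -/
theorem IsProjOnto.exists_equiv (hψ : IsCharOn H ψ) (hQ : IsProjOnto H ψ U Q)
    (hirr : isIrredOn hQ.repOn) (W : RepOn G) (hW : isIrredOn W) {v : W.carrier} (hv0 : v ≠ 0)
    (hv : ∀ h ∈ H, W.ρ h v = ψ h • v)
    (hT : ∀ f ∈ equivFns H ψ, fromFns W.ρ v (Q f) = fromFns W.ρ v f) :
    ∃ e : hQ.repOn.carrier ≃ₗ[ℂ] W.carrier, ∀ g f, e (hQ.repOn.ρ g f) = W.ρ g (e f) := by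
  let T : U →ₗ[ℂ] W.carrier := (fromFns W.ρ v).comp U.subtype
  have hTg (g : G) (f : U) : T (hQ.rep g f) = W.ρ g (T f) := fromFns_rightReg W.ρ v g f
  have hTe : T ⟨Q (extendZero H ψ), hQ.mem _ (extendZero_mem_equivFns hψ)⟩ ≠ 0 := by
    have h1 := hT _ (extendZero_mem_equivFns hψ)
    rw [fromFns_extendZero W.ρ hψ hv] at h1
    exact h1.trans_ne (smul_ne_zero (Nat.cast_ne_zero.2 Nat.card_pos.ne') hv0)
  have hirr' : ∀ S : Submodule ℂ U, (∀ g, ∀ f ∈ S, hQ.rep g f ∈ S) → S = ⊥ ∨ S = ⊤ := hirr.2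
  have hker : LinearMap.ker T = ⊥ := by
    refine (hirr' (LinearMap.ker T) fun g f (hf : T f = 0) => ?_).resolve_right fun h => ?_
    · exact (hTg g f).trans (by rw [hf, map_zero])
    · exact hTe (LinearMap.mem_ker.1 (h ▸ Submodule.mem_top))
  have hrange : LinearMap.range T = ⊤ := by
    refine (hW.2 (LinearMap.range T) ?_).resolve_left fun h => ?_
    · rintro g _ ⟨f, rfl⟩
      exact ⟨hQ.rep g f, hTg g f⟩
    · exact hTe ((Submodule.mem_bot ℂ).1 (h ▸ LinearMap.mem_range_self T _))
  exact ⟨LinearEquiv.ofBijective T ⟨LinearMap.ker_eq_bot.1 hker, LinearMap.range_eq_top.1 hrange⟩,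
    hTg⟩

end RepOn

/-! ### Arithmetic in `ℤ/pⁿℤ` -/

section ZModPrimePow

variable {p n : ℕ}

theorem isNilpotent_natCast_prime : IsNilpotent (p : ZMod (p ^ n)) :=
  ⟨n, by rw [← Nat.cast_pow, ZMod.natCast_self]⟩

theorem natCast_modEq_of_dvd_sub {k : ℕ} (hk : k ≤ n) {i j : ℕ}
    (h : (p : ZMod (p ^ n)) ^ k ∣ (i : ZMod (p ^ n)) - j) : i ≡ j [MOD p ^ k] := by
  have h1 := map_dvd (ZMod.castHom (pow_dvd_pow p hk) (ZMod (p ^ k))) h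
  rw [map_pow, map_sub, map_natCast, map_natCast, map_natCast, ← Nat.cast_pow,
    ZMod.natCast_self, zero_dvd_iff, sub_eq_zero] at h1
  exact (ZMod.natCast_eq_natCast_iff _ _ _).1 h1

theorem isUnit_one_add_of_dvd {x : ZMod (p ^ n)} (h : (p : ZMod (p ^ n)) ∣ x) :
    IsUnit (1 + x) := by
  obtain ⟨z, rfl⟩ := h
  exact ((Commute.all _ z).isNilpotent_mul_right isNilpotent_natCast_prime).isUnit_one_add

variable [Fact p.Prime]

theorem isUnit_or_dvd (x : ZMod (p ^ n)) : IsUnit x ∨ (p : ZMod (p ^ n)) ∣ x := by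
  have hp : p.Prime := Fact.out
  rw [← ZMod.natCast_zmod_val x]
  by_cases h : p ∣ x.val
  · exact Or.inr (Nat.cast_dvd_cast h)
  · exact Or.inl ((ZMod.isUnit_iff_coprime _ _).2
      (Nat.Coprime.pow_right n (hp.coprime_iff_not_dvd.2 h).symm))

theorem not_isUnit_of_dvd (hn : 1 ≤ n) {x : ZMod (p ^ n)} (h : (p : ZMod (p ^ n)) ∣ x) :
    ¬ IsUnit x := by
  have : Fact (1 < p ^ n) := ⟨Nat.one_lt_pow (by lia) (Fact.out : p.Prime).one_lt⟩
  exact fun hx => isNilpotent_natCast_prime.not_isUnit (isUnit_of_dvd_unit h hx)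

theorem exists_lt_dvd_sub (k : ℕ) (x : ZMod (p ^ n)) :
    ∃ i : Fin (p ^ k), (p : ZMod (p ^ n)) ^ k ∣ x - ((i : ℕ) : ZMod (p ^ n)) := by
  refine ⟨⟨x.val % p ^ k, Nat.mod_lt _ (pow_pos (Fact.out : p.Prime).pos _)⟩,
    ((x.val / p ^ k : ℕ) : ZMod (p ^ n)), ?_⟩
  rw [sub_eq_iff_eq_add, ← Nat.cast_pow, ← Nat.cast_mul, ← Nat.cast_add, Nat.div_add_mod,
    ZMod.natCast_zmod_val]

theorem not_pow_dvd_pow_pred {k : ℕ} (hk : 1 ≤ k) (hkn : k ≤ n) :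
    ¬ (p : ZMod (p ^ n)) ^ k ∣ (p : ZMod (p ^ n)) ^ (k - 1) := by
  intro h
  have h1 := natCast_modEq_of_dvd_sub hkn (i := p ^ (k - 1)) (j := 0) (by simpa using h)
  have h2 := (Nat.pow_dvd_pow_iff_le_right (Fact.out : p.Prime).one_lt).1
    ((Nat.modEq_zero_iff_dvd).1 h1)
  lia

theorem exists_eq_pow_mul_unit (x : ZMod (p ^ n)) :
    ∃ (j : ℕ) (u : (ZMod (p ^ n))ˣ), x = (p : ZMod (p ^ n)) ^ j * u := by
  by_cases hx : x = 0
  · exact ⟨n, 1, by rw [hx, ← Nat.cast_pow, ZMod.natCast_self, zero_mul]⟩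
  · have hp : p.Prime := Fact.out
    have h0 : x.val ≠ 0 := by rwa [ne_eq, ZMod.val_eq_zero]
    obtain ⟨j, m, hm, hxm⟩ := Nat.exists_eq_pow_mul_and_not_dvd h0 p hp.ne_one
    have hu : IsUnit (m : ZMod (p ^ n)) := (ZMod.isUnit_iff_coprime _ _).2
      (Nat.Coprime.pow_right n (hp.coprime_iff_not_dvd.2 hm).symm)
    refine ⟨j, hu.unit, ?_⟩
    rw [IsUnit.unit_spec, ← Nat.cast_pow, ← Nat.cast_mul, ← hxm, ZMod.natCast_zmod_val]

end ZModPrimePow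

/-! ### Entries of invertible matrices -/

section Entries

variable {R : Type*} [CommRing R]

theorem GL_mul_apply (g h : GL (Fin 2) R) (i j : Fin 2) :
    (g * h) i j = g i 0 * h 0 j + g i 1 * h 1 j := by
  rw [Units.val_mul, Matrix.mul_apply, Fin.sum_univ_two]

theorem isUnit_det_entries (g : GL (Fin 2) R) : IsUnit (g 0 0 * g 1 1 - g 0 1 * g 1 0) := by
  rw [← Matrix.det_fin_two]
  exact (Matrix.isUnit_iff_isUnit_det _).1 g.isUnit

theorem chiB_eq {χ : Rˣ →* ℂˣ} {g : GL (Fin 2) R} {u : Rˣ} (h : g 1 1 = u) :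
    chiB χ g = χ u := by
  have hu : IsUnit (g 1 1) := h ▸ u.isUnit
  have h2 : hu.unit = u := Units.ext h
  rw [chiB, dif_pos hu, h2]

/-- The invertible upper triangular matrix `(a, b; 0, d)`. -/
def upperG (a d : Rˣ) (b : R) : GL (Fin 2) R :=
  ⟨!![a, b; 0, d], !![↑a⁻¹, -(↑a⁻¹ * b * ↑d⁻¹); 0, ↑d⁻¹],
   by ext i j; fin_cases i <;> fin_cases j <;> simp [Matrix.mul_apply, Fin.sum_univ_two, mul_assoc],
   by ext i j; fin_cases i <;> fin_cases j <;> simp [Matrix.mul_apply, Fin.sum_univ_two]⟩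

/-- The matrix `(0, -1; 1, d)`. -/
def weylG (d : R) : GL (Fin 2) R :=
  ⟨!![0, -1; 1, d], !![d, 1; -1, 0],
   by ext i j; fin_cases i <;> fin_cases j <;> simp [Matrix.mul_apply, Fin.sum_univ_two],
   by ext i j; fin_cases i <;> fin_cases j <;> simp [Matrix.mul_apply, Fin.sum_univ_two]⟩

theorem mul_yG_inv_apply (g : GL (Fin 2) R) (t : R) : (g * (yG t)⁻¹) 1 0 = g 1 0 - g 1 1 * t := by
  rw [GL_mul_apply]
  simp [yG, sub_eq_add_neg]

theorem mul_weylG_inv_apply (g : GL (Fin 2) R) (t : R) :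
    (g * (weylG t)⁻¹) 1 0 = g 1 0 * t - g 1 1 := by
  rw [GL_mul_apply]
  simp [weylG, sub_eq_add_neg]

end Entries

/-! ### The groups `B_k` -/

section Bk

variable {p n : ℕ}

/-- `B_k` as a subgroup. -/
def subBk (p n k : ℕ) : Subgroup (GL (Fin 2) (ZMod (p ^ n))) where
  carrier := {g | inBk p n k g}
  one_mem' := by simp [inBk]
  mul_mem' := by
    intro a b ha hb
    simp only [Set.mem_ofPred_eq, inBk] at *
    rw [GL_mul_apply]
    exact dvd_add (ha.mul_right _) (hb.mul_left _)
  inv_mem' := by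
    intro a ha
    simp only [Set.mem_ofPred_eq, inBk] at *
    rw [Matrix.coe_units_inv, Matrix.inv_def, Matrix.adjugate_fin_two]
    simpa using ha

theorem mem_subBk {k : ℕ} {g : GL (Fin 2) (ZMod (p ^ n))} :
    g ∈ subBk p n k ↔ (p : ZMod (p ^ n)) ^ k ∣ g 1 0 := Iff.rfl

theorem subBk_mono {k l : ℕ} (h : l ≤ k) : subBk p n k ≤ subBk p n l :=
  fun _ hg => (pow_dvd_pow _ h).trans hg

theorem chi_eq_of_dvd_sub {r : ℕ} {χ : (ZMod (p ^ n))ˣ →* ℂˣ} (hχ : hasConductor p n r χ)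
    {u v : (ZMod (p ^ n))ˣ} (h : (p : ZMod (p ^ n)) ^ r ∣ u - v) : χ u = χ v := by
  have h1 : χ (u * v⁻¹) = 1 := by
    apply hχ.1
    have h2 : ((u * v⁻¹ : (ZMod (p ^ n))ˣ) : ZMod (p ^ n)) - 1 = (u - v) * ↑v⁻¹ := by
      rw [sub_mul, Units.mul_inv, Units.val_mul]
    rw [h2]
    exact h.mul_right _
  rwa [map_mul, map_inv, mul_inv_eq_one] at h1

variable [Fact p.Prime]

theorem isUnit_of_mem_subBk (hn : 1 ≤ n) {k : ℕ} (hk : 1 ≤ k) {g : GL (Fin 2) (ZMod (p ^ n))}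
    (hg : g ∈ subBk p n k) : IsUnit (g 1 1) := by
  refine (isUnit_or_dvd _).resolve_right fun h => ?_
  have hc : (p : ZMod (p ^ n)) ∣ g 1 0 := (dvd_pow_self _ (by lia)).trans hg
  exact not_isUnit_of_dvd hn (dvd_sub (h.mul_left _) (hc.mul_left _)) (isUnit_det_entries g)

theorem isCharOn_chiB (hn : 1 ≤ n) {r k : ℕ} (hr : 1 ≤ r) (hrk : r ≤ k)
    {χ : (ZMod (p ^ n))ˣ →* ℂˣ} (hχ : hasConductor p n r χ) :
    IsCharOn (subBk p n k) (chiB χ) where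
  map_one := by rw [chiB_eq (u := 1) (by simp)]; simp
  map_mul a ha b hb := by
    obtain ⟨u, hu⟩ := isUnit_of_mem_subBk hn (hr.trans hrk) ha
    obtain ⟨v, hv⟩ := isUnit_of_mem_subBk hn (hr.trans hrk) hb
    obtain ⟨w, hw⟩ := isUnit_of_mem_subBk hn (hr.trans hrk) ((subBk p n k).mul_mem ha hb)
    rw [chiB_eq hu.symm, chiB_eq hv.symm, chiB_eq hw.symm, ← Units.val_mul, ← map_mul]
    congr 1
    apply chi_eq_of_dvd_sub hχ
    rw [hw, GL_mul_apply, Units.val_mul, hu, hv, add_sub_cancel_right]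
    exact ((pow_dvd_pow _ hrk).trans ha).mul_right _

/-- Coset representatives for `B_k`. -/
def cosetRep (p n k : ℕ) : Fin (p ^ (k - 1)) ⊕ Fin (p ^ k) → GL (Fin 2) (ZMod (p ^ n))
  | Sum.inl i => yG (p * (i : ℕ))
  | Sum.inr j => weylG ((j : ℕ) : ZMod (p ^ n))

theorem cosetRep_injective (hn : 1 ≤ n) {k : ℕ} (hk : 1 ≤ k) (hkn : k ≤ n)
    (i j : Fin (p ^ (k - 1)) ⊕ Fin (p ^ k))
    (h : cosetRep p n k j * (cosetRep p n k i)⁻¹ ∈ subBk p n k) : i = j := by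
  have hp : p.Prime := Fact.out
  have hdvd {x : ZMod (p ^ n)} (hx : (p : ZMod (p ^ n)) ^ k ∣ x) : ¬ IsUnit x :=
    not_isUnit_of_dvd hn ((dvd_pow_self _ (by lia)).trans hx)
  rw [mem_subBk] at h
  rcases i with i | i <;> rcases j with j | j <;>
    simp only [cosetRep, mul_yG_inv_apply, mul_weylG_inv_apply] at h
  · have h1 : p * j ≡ p * i [MOD p ^ k] := by
      apply natCast_modEq_of_dvd_sub hkn
      simpa [yG] using h
    have hlt (m : Fin (p ^ (k - 1))) : p * m < p ^ k := by
      have h3 : p ^ k = p * p ^ (k - 1) := by rw [← pow_succ', Nat.sub_add_cancel hk]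
      rw [h3]
      exact Nat.mul_lt_mul_of_pos_left m.2 hp.pos
    have h2 := Nat.eq_of_mul_eq_mul_left hp.pos (h1.eq_of_lt_of_lt (hlt j) (hlt i))
    rw [Fin.ext h2]
  · refine absurd ?_ (hdvd h)
    have h1 := isUnit_one_add_of_dvd (x := -((j : ℕ) * (p * (i : ℕ)) : ZMod (p ^ n)))
      (Dvd.intro (-((j : ℕ) * (i : ℕ) : ZMod (p ^ n))) (by ring))
    simpa [weylG, sub_eq_add_neg] using h1
  · refine absurd ?_ (hdvd h)
    have h1 := (isUnit_one_add_of_dvd (x := -((i : ℕ) * (p * (j : ℕ)) : ZMod (p ^ n)))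
      (Dvd.intro (-((i : ℕ) * (j : ℕ) : ZMod (p ^ n))) (by ring))).neg
    convert h1 using 1
    simp [yG]
    ring
  · have h1 : i ≡ j [MOD p ^ k] := by
      apply natCast_modEq_of_dvd_sub hkn
      simpa [weylG] using h
    rw [Fin.ext (h1.eq_of_lt_of_lt i.2 j.2)]

theorem cosetRep_surjective (hn : 1 ≤ n) {k : ℕ} (hk : 1 ≤ k) (x : GL (Fin 2) (ZMod (p ^ n))) :
    ∃ i, x * (cosetRep p n k i)⁻¹ ∈ subBk p n k := by
  rcases isUnit_or_dvd (x 1 0) with ⟨c, hc⟩ | hc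
  · obtain ⟨j, hj⟩ := exists_lt_dvd_sub k (((c⁻¹ : (ZMod (p ^ n))ˣ) : ZMod (p ^ n)) * x 1 1)
    refine ⟨Sum.inr j, ?_⟩
    rw [mem_subBk, cosetRep, mul_weylG_inv_apply]
    have h1 : x 1 0 * (j : ℕ) - x 1 1 = -(c * (↑c⁻¹ * x 1 1 - (j : ℕ))) := by
      rw [mul_sub, Units.mul_inv_cancel_left, hc]
      ring
    rw [h1]
    exact (hj.mul_left _).neg_right
  · obtain ⟨d, hd⟩ := isUnit_of_mem_subBk (k := 1) hn le_rfl
      (mem_subBk.2 ((pow_one (p : ZMod (p ^ n))).symm ▸ hc))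
    obtain ⟨z, hz⟩ := hc
    obtain ⟨i, hi⟩ := exists_lt_dvd_sub (k - 1) (((d⁻¹ : (ZMod (p ^ n))ˣ) : ZMod (p ^ n)) * z)
    refine ⟨Sum.inl i, ?_⟩
    rw [mem_subBk, cosetRep, mul_yG_inv_apply]
    have h1 : x 1 0 - x 1 1 * (p * (i : ℕ)) = p * (↑d⁻¹ * z - (i : ℕ)) * d := by
      have h2 : z = d * (↑d⁻¹ * z) := by rw [Units.mul_inv_cancel_left]
      rw [hz, ← hd]
      linear_combination (p : ZMod (p ^ n)) * h2
    have h3 : (p : ZMod (p ^ n)) ^ k = p * p ^ (k - 1) := by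
      rw [← pow_succ', Nat.sub_add_cancel hk]
    rw [h1, h3]
    exact (mul_dvd_mul_left _ hi).mul_right _

theorem finrank_equivFns_subBk (hn : 1 ≤ n) {k : ℕ} (hk : 1 ≤ k) (hkn : k ≤ n)
    {ψ : GL (Fin 2) (ZMod (p ^ n)) → ℂ} (hψ : IsCharOn (subBk p n k) ψ) :
    Module.finrank ℂ (equivFns (subBk p n k) ψ) = p ^ (k - 1) * (p + 1) := by
  rw [finrank_equivFns hψ (cosetRep p n k) (cosetRep_injective hn hk hkn)
    (cosetRep_surjective hn hk), Fintype.card_sum, Fintype.card_fin, Fintype.card_fin, mul_add,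
    ← pow_succ, Nat.sub_add_cancel hk, mul_one, add_comm]

end Bk

/-! ### Bi-equivariant functions -/

section BiEquivariant

variable {p n k : ℕ} {χ : (ZMod (p ^ n))ˣ →* ℂˣ} {f : GL (Fin 2) (ZMod (p ^ n)) → ℂ}

theorem upperG_mem_subBk (a d : (ZMod (p ^ n))ˣ) (b : ZMod (p ^ n)) :
    upperG a d b ∈ subBk p n k := by
  simp [mem_subBk, upperG]

theorem chiB_upperG (a d : (ZMod (p ^ n))ˣ) (b : ZMod (p ^ n)) :
    chiB χ (upperG a d b) = χ d :=
  chiB_eq (by simp [upperG])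

theorem yG_mem_subBk {t : ZMod (p ^ n)} : yG t ∈ subBk p n k ↔ (p : ZMod (p ^ n)) ^ k ∣ t := by
  simp [mem_subBk, yG]

theorem chiB_yG (t : ZMod (p ^ n)) : chiB χ (yG t) = 1 := by
  rw [chiB_eq (u := 1) (by simp [yG])]
  simp

theorem apply_eq_chi_mul_apply_yG (hf : f ∈ equivFns (subBk p n k) (chiB χ))
    {x : GL (Fin 2) (ZMod (p ^ n))} {u : (ZMod (p ^ n))ˣ} (hu : x 1 1 = u) :
    f x = χ u * f (yG (x 1 0 * ↑u⁻¹)) := by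
  set t : ZMod (p ^ n) := x 1 0 * ↑u⁻¹
  have h1 : x * (yG t)⁻¹ ∈ subBk p n k := by
    rw [mem_subBk, mul_yG_inv_apply, hu, mul_comm, Units.inv_mul_cancel_right, sub_self]
    exact dvd_zero _
  have h2 : chiB χ (x * (yG t)⁻¹) = χ u := by
    apply chiB_eq
    rw [GL_mul_apply]
    simp [yG, hu]
  rw [← h2, ← hf _ h1, inv_mul_cancel_right]

theorem apply_yG_mul_unit (hf : f ∈ equivFns (subBk p n k) (chiB χ))
    (hf' : IsRightFixed (subBk p n k) (chiB χ) f) (t : ZMod (p ^ n)) (u : (ZMod (p ^ n))ˣ) :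
    f (yG (t * u)) = f (yG t) := by
  have h1 : yG (t * u) = upperG u⁻¹ 1 0 * yG t * upperG u 1 0 := by
    ext i j
    rw [GL_mul_apply, GL_mul_apply, GL_mul_apply]
    fin_cases i <;> fin_cases j <;> simp [yG, upperG]
  rw [h1, hf' _ (upperG_mem_subBk _ _ _), hf _ (upperG_mem_subBk _ _ _), chiB_upperG, chiB_upperG]
  simp

theorem apply_yG_of_dvd (hf : f ∈ equivFns (subBk p n k) (chiB χ)) {t : ZMod (p ^ n)}
    (ht : (p : ZMod (p ^ n)) ^ k ∣ t) : f (yG t) = f 1 := by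
  rw [← mul_one (yG t), hf _ (yG_mem_subBk.2 ht), chiB_yG, one_mul]

theorem apply_yG_eq_zero_of_lt {r j : ℕ} (hχ : hasConductor p n r χ) (hj : j < r)
    (hf : f ∈ equivFns (subBk p n k) (chiB χ)) (hf' : IsRightFixed (subBk p n k) (chiB χ) f) :
    f (yG ((p : ZMod (p ^ n)) ^ j)) = 0 := by
  obtain ⟨v, hv, hv1⟩ := hχ.2
  obtain ⟨s, hs⟩ := (pow_dvd_pow _ (by lia : j ≤ r - 1)).trans hv
  have h1 : upperG v 1 (-s) * yG ((p : ZMod (p ^ n)) ^ j) =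
      yG ((p : ZMod (p ^ n)) ^ j) * upperG 1 v (-s) := by
    have hs' : (v : ZMod (p ^ n)) = 1 + p ^ j * s := by rw [← hs]; ring
    ext i l
    rw [GL_mul_apply, GL_mul_apply]
    fin_cases i <;> fin_cases l <;> simp [yG, upperG, hs']
    ring
  have h2 := congrArg f h1
  rw [hf _ (upperG_mem_subBk _ _ _), hf' _ (upperG_mem_subBk _ _ _), chiB_upperG, chiB_upperG,
    map_one, Units.val_one] at h2
  by_contra h0
  exact hv1 (Units.ext (mul_right_cancel₀ h0 h2.symm))

variable [Fact p.Prime]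

/-- A bi-equivariant function is determined by its values at `(1,0;p^j,1)` for `r ≤ j ≤ k`. -/
theorem eq_zero_of_apply_yG {r : ℕ} (hn : 1 ≤ n) (hrk : r ≤ k) (hχ : hasConductor p n r χ)
    (hf : f ∈ equivFns (subBk p n k) (chiB χ)) (hf' : IsRightFixed (subBk p n k) (chiB χ) f)
    (h : ∀ j, r ≤ j → j ≤ k → f (yG ((p : ZMod (p ^ n)) ^ j)) = 0) : f = 0 := by
  have hy (t : ZMod (p ^ n)) : f (yG t) = 0 := by
    obtain ⟨j, u, rfl⟩ := exists_eq_pow_mul_unit t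
    rw [apply_yG_mul_unit hf hf']
    rcases lt_or_ge j r with hj | hj
    · exact apply_yG_eq_zero_of_lt hχ hj hf hf'
    rcases le_total j k with hjk | hjk
    · exact h j hj hjk
    · rw [apply_yG_of_dvd hf (pow_dvd_pow _ hjk), ← apply_yG_of_dvd hf dvd_rfl]
      exact h k hrk le_rfl
  have hu (x : GL (Fin 2) (ZMod (p ^ n))) (hx : IsUnit (x 1 1)) : f x = 0 := by
    obtain ⟨u, hu⟩ := hx
    rw [apply_eq_chi_mul_apply_yG hf hu.symm, hy, mul_zero]
  ext x
  rcases isUnit_or_dvd (x 1 0) with ⟨c, hc⟩ | hc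
  · have h1 := hf' (upperG 1 1 (↑c⁻¹ * (1 - x 1 1))) (upperG_mem_subBk _ _ _) x
    rw [hu, chiB_upperG, map_one, Units.val_one, one_mul] at h1
    · exact h1.symm
    · rw [GL_mul_apply, ← hc]
      simp [upperG]
  · exact hu x (isUnit_of_mem_subBk (k := 1) hn le_rfl
      (mem_subBk.2 ((pow_one (p : ZMod (p ^ n))).symm ▸ hc)))

/-- A bi-equivariant function in the kernel of the projection to level `k - 1` is determined by its
value at `1`. -/
theorem eq_zero_of_leftAvg_eq_zero {r : ℕ} (hn : 1 ≤ n) (hr : 1 ≤ r) (hrk : r < k) (hkn : k ≤ n)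
    (hχ : hasConductor p n r χ)
    (hf : f ∈ equivFns (subBk p n k) (chiB χ)) (hf' : IsRightFixed (subBk p n k) (chiB χ) f)
    (hK : leftAvg (subBk p n (k - 1)) (chiB χ) f = 0) (h1 : f 1 = 0) : f = 0 := by
  classical
  have hψ : IsCharOn (subBk p n (k - 1)) (chiB χ) := isCharOn_chiB hn hr (by lia) hχ
  have hsum (x : GL (Fin 2) (ZMod (p ^ n))) :
      ∑ b : subBk p n (k - 1), chiB χ (b : GL (Fin 2) (ZMod (p ^ n)))⁻¹ * f (b * x) = 0 := by
    have h2 := congrFun hK x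
    rw [leftAvg_apply] at h2
    exact (mul_eq_zero.1 h2).resolve_left (by simp)
  have hcancel (b : subBk p n (k - 1)) (z : ℂ) :
      chiB χ (b : GL (Fin 2) (ZMod (p ^ n)))⁻¹ * (chiB χ b * z) = z := by
    rw [← mul_assoc, mul_comm (chiB χ _), hψ.mul_inv b.2, one_mul]
  have hterm (b : subBk p n (k - 1)) : ∃ z : ZMod (p ^ n),
      (b : GL (Fin 2) (ZMod (p ^ n))) 1 0 = (p : ZMod (p ^ n)) ^ (k - 1) * z ∧
      ∃ u : (ZMod (p ^ n))ˣ, ∀ t, f ((b : GL (Fin 2) (ZMod (p ^ n))) * yG t) =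
        chiB χ b * f (yG (t + (p : ZMod (p ^ n)) ^ (k - 1) * z * u)) := by
    obtain ⟨z, hz⟩ := mem_subBk.1 b.2
    obtain ⟨u, hu⟩ := isUnit_of_mem_subBk hn (by lia) b.2
    refine ⟨z, hz, u⁻¹, fun t => ?_⟩
    have h3 : ((b : GL (Fin 2) (ZMod (p ^ n))) * yG t) 1 1 = u := by
      rw [GL_mul_apply, hu]
      simp [yG]
    have h4 : ((b : GL (Fin 2) (ZMod (p ^ n))) * yG t) 1 0 * ↑u⁻¹ =
        t + (p : ZMod (p ^ n)) ^ (k - 1) * z * ↑u⁻¹ := by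
      rw [GL_mul_apply, ← hz, ← hu]
      simp [yG]
      linear_combination t * u.mul_inv
    rw [apply_eq_chi_mul_apply_yG hf h3, chiB_eq hu.symm, h4]
  have hlow (j : ℕ) (hj : j + 1 < k) : f (yG ((p : ZMod (p ^ n)) ^ j)) = 0 := by
    have h2 := hsum (yG ((p : ZMod (p ^ n)) ^ j))
    have h3 (b : subBk p n (k - 1)) : chiB χ (b : GL (Fin 2) (ZMod (p ^ n)))⁻¹ *
        f (b * yG ((p : ZMod (p ^ n)) ^ j)) = f (yG ((p : ZMod (p ^ n)) ^ j)) := by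
      obtain ⟨z, -, u, hb⟩ := hterm b
      have hpow : (p : ZMod (p ^ n)) ^ (k - 1) = p ^ j * p ^ (k - 1 - j) := by
        rw [← pow_add]
        congr 1
        lia
      obtain ⟨w, hw⟩ := isUnit_one_add_of_dvd
        (x := (p : ZMod (p ^ n)) ^ (k - 1 - j) * z * (u : ZMod (p ^ n)))
        (((dvd_pow_self _ (by lia)).mul_right z).mul_right _)
      have h4 : (p : ZMod (p ^ n)) ^ j + p ^ (k - 1) * z * u = p ^ j * w := by
        rw [hw, hpow]
        ring
      rw [hb, hcancel, h4, apply_yG_mul_unit hf hf']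
    rw [Finset.sum_congr rfl fun b _ => h3 b, Finset.sum_const, smul_eq_zero] at h2
    exact h2.resolve_left (by simp)
  have hpred : f (yG ((p : ZMod (p ^ n)) ^ (k - 1))) = 0 := by
    have h2 := hsum (yG 0)
    have h3 (b : subBk p n (k - 1)) : chiB χ (b : GL (Fin 2) (ZMod (p ^ n)))⁻¹ *
        f ((b : GL (Fin 2) (ZMod (p ^ n))) * yG 0) =
          if (b : GL (Fin 2) (ZMod (p ^ n))) ∉ subBk p n k then
            f (yG ((p : ZMod (p ^ n)) ^ (k - 1))) else 0 := by
      obtain ⟨z, hz, u, hb⟩ := hterm b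
      have hpow : (p : ZMod (p ^ n)) ^ k = p ^ (k - 1) * p := by
        rw [← pow_succ, Nat.sub_add_cancel (by lia)]
      rw [hb, hcancel, zero_add]
      split_ifs with h
      · rw [mem_subBk, hz] at h
        rw [apply_yG_of_dvd hf (h.mul_right _), h1]
      · obtain ⟨w, rfl⟩ := (isUnit_or_dvd z).resolve_right fun hpz => h <| by
          rw [mem_subBk, hz, hpow]
          exact mul_dvd_mul_left _ hpz
        rw [apply_yG_mul_unit hf hf', apply_yG_mul_unit hf hf']
    rw [Finset.sum_congr rfl fun b _ => h3 b, ← Finset.sum_filter, Finset.sum_const,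
      smul_eq_zero] at h2
    refine h2.resolve_left fun hcard => ?_
    rw [Finset.card_eq_zero] at hcard
    have hmem : (⟨yG ((p : ZMod (p ^ n)) ^ (k - 1)), yG_mem_subBk.2 dvd_rfl⟩ :
        subBk p n (k - 1)) ∈ Finset.univ.filter
          fun b : subBk p n (k - 1) => (b : GL (Fin 2) (ZMod (p ^ n))) ∉ subBk p n k := by
      exact Finset.mem_filter.2 ⟨Finset.mem_univ _,
        fun h => not_pow_dvd_pow_pred (by lia) hkn (yG_mem_subBk.1 h)⟩
    rw [hcard] at hmem
    exact Finset.notMem_empty _ hmem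
  refine eq_zero_of_apply_yG hn hrk.le hχ hf hf' fun j _ hjk => ?_
  rcases lt_trichotomy (j + 1) k with hj | hj | hj
  · exact hlow j hj
  · rw [← hpred, ← hj, Nat.add_sub_cancel]
  · rw [apply_yG_of_dvd hf (pow_dvd_pow _ (by lia)), h1]

end BiEquivariant

section Sigma

variable {p n k : ℕ} {χ : (ZMod (p ^ n))ˣ →* ℂˣ}
  {U : Submodule ℂ (GL (Fin 2) (ZMod (p ^ n)) → ℂ)}
  {Q : (GL (Fin 2) (ZMod (p ^ n)) → ℂ) →ₗ[ℂ] (GL (Fin 2) (ZMod (p ^ n)) → ℂ)}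

theorem isFixedVec_repOn_iff {l : ℕ} (hQ : IsProjOnto (subBk p n k) (chiB χ) U Q) (f : U) :
    isFixedVec p n l χ hQ.repOn f ↔ IsRightFixed (subBk p n l) (chiB χ) f := by
  refine forall₂_congr fun b _ => ?_
  exact (Subtype.ext_iff (a1 := hQ.rep b f) (a2 := chiB χ b • f)).trans funext_iff

theorem exists_eq_smul_of_isFixedVec (hQ : IsProjOnto (subBk p n k) (chiB χ) U Q)
    (hU : ∀ f ∈ U, IsRightFixed (subBk p n k) (chiB χ) f → f 1 = 0 → f = 0)
    (v w : hQ.repOn.carrier) (hv0 : v ≠ 0) (hv : isFixedVec p n k χ hQ.repOn v)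
    (hw : isFixedVec p n k χ hQ.repOn w) : ∃ c : ℂ, w = c • v := by
  have key (f : U) (hf : isFixedVec p n k χ hQ.repOn f) (hf1 : f.1 1 = 0) : f = 0 :=
    Subtype.ext (hU f.1 f.2 ((isFixedVec_repOn_iff hQ f).1 hf) hf1)
  have hv1 : v.1 1 ≠ 0 := fun h => hv0 (key v hv h)
  refine ⟨w.1 1 / v.1 1, sub_eq_zero.1 (key _ (fun b hb => ?_) ?_)⟩
  · rw [map_sub, map_smul, hv b hb, hw b hb, smul_sub, smul_comm]
  · change w.1 1 - (w.1 1 / v.1 1) * v.1 1 = 0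
    rw [div_mul_cancel₀ _ hv1, sub_self]

theorem exists_isFixedVec_repOn [Fact p.Prime] (hψ : IsCharOn (subBk p n k) (chiB χ))
    (hQ : IsProjOnto (subBk p n k) (chiB χ) U Q) (hne : U ≠ ⊥) :
    ∃ v : hQ.repOn.carrier, v ≠ 0 ∧ isFixedVec p n k χ hQ.repOn v := by
  obtain ⟨f, hfU, hf, hf1⟩ := exists_isRightFixed hψ hQ.le (fun g _ h => hQ.rightReg_mem g h) hne
  refine ⟨⟨f, hfU⟩, fun h => hf1 ?_, (isFixedVec_repOn_iff hQ ⟨f, hfU⟩).2 hf⟩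
  exact congrFun (congrArg Subtype.val h) 1

end Sigma

/-- For each `r ≤ k ≤ n` there is an irreducible representation `σ(k)` of `G`, unique up
to isomorphism, with a nonzero `(χ,B_k)`-fixed vector and (for `k > r`) no nonzero
`(χ,B_{k−1})`-fixed vector; its `(χ,B_k)`-fixed vector is unique up to scalars, and
`dim σ(r) = p^{r−1}(p+1)`, `dim σ(k) = p^{k−2}(p²−1)` for `r < k ≤ n`. -/
theorem stmt12 (p n r : ℕ) [Fact p.Prime] (hn : 1 ≤ n) (hr : 1 ≤ r) (hrn : r ≤ n)
    (χ : (ZMod (p ^ n))ˣ →* ℂˣ) (hχ : hasConductor p n r χ) :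
    ∀ k : ℕ, r ≤ k → k ≤ n →
      ∃ W : RepOn (GL (Fin 2) (ZMod (p ^ n))),
        sigmaProp p n r k χ W ∧
        (∀ v w : W.carrier, v ≠ 0 → isFixedVec p n k χ W v → isFixedVec p n k χ W w →
          ∃ c : ℂ, w = c • v) ∧
        (k = r → Module.finrank ℂ W.carrier = p ^ (r - 1) * (p + 1)) ∧
        (r < k → Module.finrank ℂ W.carrier = p ^ (k - 2) * (p ^ 2 - 1)) ∧
        (∀ W' : RepOn (GL (Fin 2) (ZMod (p ^ n))), sigmaProp p n r k χ W' →
          ∃ e : W.carrier ≃ₗ[ℂ] W'.carrier, ∀ g v, e (W.ρ g v) = W'.ρ g (e v)) := by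
  intro k hrk hkn
  have hψ : IsCharOn (subBk p n k) (chiB χ) := isCharOn_chiB hn hr hrk hχ
  have hV := finrank_equivFns_subBk hn (hr.trans hrk) hkn hψ
  have hp : p.Prime := Fact.out
  rcases hrk.eq_or_lt with rfl | hlt
  · have hQ := isProjOnto_id (subBk p n r) (chiB χ)
    have hU : ∀ f ∈ equivFns (subBk p n r) (chiB χ), IsRightFixed (subBk p n r) (chiB χ) f →
        f 1 = 0 → f = 0 := fun f hf hf' h1 =>
      eq_zero_of_apply_yG hn le_rfl hχ hf hf' fun j hj _ => by
        rw [apply_yG_of_dvd hf (pow_dvd_pow _ hj), h1]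
    have hne : equivFns (subBk p n r) (chiB χ) ≠ ⊥ := by
      intro h
      rw [h, finrank_bot] at hV
      exact (Nat.mul_pos (pow_pos hp.pos _) p.succ_pos).ne hV
    have hirr := hQ.isIrredOn_repOn hψ hU hne
    refine ⟨hQ.repOn, ⟨hirr, exists_isFixedVec_repOn hψ hQ hne, fun h => absurd h (lt_irrefl _)⟩,
      exists_eq_smul_of_isFixedVec hQ hU, fun _ => hV, fun h => absurd h (lt_irrefl _), ?_⟩
    rintro W ⟨hW, ⟨v, hv0, hv⟩, -⟩
    exact hQ.exists_equiv hψ hirr W hW hv0 hv fun _ _ => rfl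
  · have hψ' : IsCharOn (subBk p n (k - 1)) (chiB χ) := isCharOn_chiB hn hr (by lia) hχ
    have hle : subBk p n k ≤ subBk p n (k - 1) := subBk_mono (by lia)
    have hQ := isProjOnto_sub_leftAvg hψ' hle
    have hU : ∀ f ∈ equivFns (subBk p n k) (chiB χ) ⊓
        LinearMap.ker (leftAvg (subBk p n (k - 1)) (chiB χ)),
        IsRightFixed (subBk p n k) (chiB χ) f → f 1 = 0 → f = 0 := fun f hf hf' h1 =>
      eq_zero_of_leftAvg_eq_zero hn hr hlt hkn hχ hf.1 hf' hf.2 h1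
    have hdim := finrank_inf_ker_leftAvg hψ' hle
    rw [hV, finrank_equivFns_subBk hn (by lia) (by lia) hψ'] at hdim
    obtain ⟨m, rfl⟩ : ∃ m, k = m + 2 := ⟨k - 2, by lia⟩
    have hdim' : Module.finrank ℂ ↥(equivFns (subBk p n (m + 2)) (chiB χ) ⊓
        LinearMap.ker (leftAvg (subBk p n (m + 2 - 1)) (chiB χ))) = p ^ m * (p ^ 2 - 1) := by
      have h1 : 1 ≤ p ^ 2 := Nat.one_le_pow _ _ hp.pos
      refine Nat.add_right_cancel (hdim.trans ?_)
      simp only [Nat.add_succ_sub_one, Nat.add_sub_cancel]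
      zify [h1]
      ring
    have hne : equivFns (subBk p n (m + 2)) (chiB χ) ⊓
        LinearMap.ker (leftAvg (subBk p n (m + 2 - 1)) (chiB χ)) ≠ ⊥ := by
      intro h
      rw [h, finrank_bot] at hdim'
      exact (Nat.mul_pos (pow_pos hp.pos _)
        (Nat.sub_pos_of_lt (Nat.one_lt_pow two_ne_zero hp.one_lt))).ne hdim'
    have hirr := hQ.isIrredOn_repOn hψ hU hne
    refine ⟨hQ.repOn, ⟨hirr, exists_isFixedVec_repOn hψ hQ hne, fun _ => ?_⟩,
      exists_eq_smul_of_isFixedVec hQ hU, fun h => absurd h hlt.ne', fun _ => hdim', ?_⟩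
    · rintro ⟨v, hv0, hv⟩
      have hv' := (isFixedVec_repOn_iff hQ v).1 hv
      refine hv0 (Subtype.ext (hU v.1 v.2 (fun b hb => hv' b (hle hb)) ?_))
      rw [← leftAvg_apply_one hψ' hv', LinearMap.mem_ker.1 v.2.2, Pi.zero_apply]
    · rintro W ⟨hW, ⟨v, hv0, hv⟩, hno⟩
      refine hQ.exists_equiv hψ hirr W hW hv0 hv fun f _ => ?_
      rw [LinearMap.sub_apply, map_sub, LinearMap.id_apply,
        fromFns_eq_zero W.ρ hψ' (fun w hw => ?_) v (leftAvg_mem hψ' f), sub_zero]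
      by_contra hw0
      exact hno hlt ⟨w, hw0, hw⟩

end
end
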